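/- Let d = 1 or d = 2, and let K and L be d-dimensional convex bodies with K ⊆ L. Then E(V_K) ≤ E(V_L), i.e., the expected volume of the convex hull of d+1 independent uniformly random points in K is at most the expected volume of the convex hull of d+1 independent uniformly random points in L. -/

import Mathlib

open MeasureTheory

/-- A convex body in `ℝ^d`: a compact convex set with nonempty interior. -/
def IsConvexBody {d : ℕ} (K : Set (EuclideanSpace ℝ (Fin d))) : Prop :=
  IsCompact K ∧ Convex ℝ K ∧ (interior K).Nonempty

/-- `E(V_K)`: the expected volume of the convex hull of `d+1` independent
uniformly random points in `K`. -/
noncomputable def expVolSimplex (d : ℕ) (K : Set (EuclideanSpace ℝ (Fin d))) : ℝ :=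
  ⨍ X : Fin (d + 1) → EuclideanSpace ℝ (Fin d) in Set.univ.pi (fun _ => K),
    (volume (convexHull ℝ (Set.range X))).toReal

namespace RandomTriangle

set_option linter.unusedSimpArgs false

open Set
open scoped ENNReal

/-- Twice the signed area of the triangle `p q r`. -/
def cross (p q r : ℝ × ℝ) : ℝ :=
  (q.1 - p.1) * (r.2 - p.2) - (q.2 - p.2) * (r.1 - p.1)

/-- The area of the triangle `p q r`. -/
noncomputable def triArea (p q r : ℝ × ℝ) : ℝ := |cross p q r| / 2

/-- The integral of the area of the triangle `p q r` over `p, q, r ∈ K`. -/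
noncomputable def triInt (K : Set (ℝ × ℝ)) : ℝ≥0∞ :=
  ∫⁻ p in K, ∫⁻ q in K, ∫⁻ r in K, ENNReal.ofReal (triArea p q r)

lemma triArea_nonneg (p q r : ℝ × ℝ) : 0 ≤ triArea p q r := by unfold triArea; positivity

lemma triArea_rotate (p q r : ℝ × ℝ) : triArea p q r = triArea q r p := by
  have : cross p q r = cross q r p := by unfold cross; ring
  rw [triArea, triArea, this]

lemma triArea_swap (p q r : ℝ × ℝ) : triArea p q r = triArea q p r := by
  have : cross p q r = -cross q p r := by unfold cross; ring
  rw [triArea, triArea, this, abs_neg]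

@[fun_prop]
lemma continuous_triArea {X : Type*} [TopologicalSpace X] {f g h : X → ℝ × ℝ}
    (hf : Continuous f) (hg : Continuous g) (hh : Continuous h) :
    Continuous fun x => triArea (f x) (g x) (h x) := by
  unfold triArea cross; fun_prop

@[fun_prop]
lemma measurable_triArea {X : Type*} [MeasurableSpace X] {f g h : X → ℝ × ℝ}
    (hf : Measurable f) (hg : Measurable g) (hh : Measurable h) :
    Measurable fun x => triArea (f x) (g x) (h x) := by
  unfold triArea cross; fun_prop

lemma triInt_eq_prod (K : Set (ℝ × ℝ)) :
    triInt K = ∫⁻ z in K ×ˢ K ×ˢ K, ENNReal.ofReal (triArea z.1 z.2.1 z.2.2) := by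
  have hm : Measurable fun z : (ℝ × ℝ) × (ℝ × ℝ) × (ℝ × ℝ) =>
      ENNReal.ofReal (triArea z.1 z.2.1 z.2.2) := by fun_prop
  rw [Measure.volume_eq_prod, setLIntegral_prod _ hm.aemeasurable]
  refine lintegral_congr fun p => ?_
  have hm' : Measurable fun z : (ℝ × ℝ) × (ℝ × ℝ) =>
      ENNReal.ofReal (triArea p z.1 z.2) := by fun_prop
  exact (setLIntegral_prod _ hm'.aemeasurable).symm

lemma volume_prod_triple (A B C : Set (ℝ × ℝ)) :
    volume (A ×ˢ B ×ˢ C) = volume A * volume B * volume C := by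
  rw [Measure.volume_eq_prod, Measure.prod_prod, Measure.volume_eq_prod (ℝ × ℝ) (ℝ × ℝ),
    Measure.prod_prod, mul_assoc]

/-- The linear map sending the standard basis of the plane to `u`, `v`. -/
noncomputable def basisMap (u v : ℝ × ℝ) : (ℝ × ℝ) →ₗ[ℝ] (ℝ × ℝ) :=
  (LinearMap.fst ℝ ℝ ℝ).smulRight u + (LinearMap.snd ℝ ℝ ℝ).smulRight v

lemma basisMap_apply (u v x : ℝ × ℝ) : basisMap u v x = x.1 • u + x.2 • v := rfl

lemma det_basisMap (u v : ℝ × ℝ) : LinearMap.det (basisMap u v) = u.1 * v.2 - u.2 * v.1 := by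
  rw [← LinearMap.det_toMatrix (Module.Basis.finTwoProd ℝ), Matrix.det_fin_two]
  simp [LinearMap.toMatrix_apply, basisMap_apply]
  ring

/-- The affine map sending the standard triangle to the triangle `a b c`. -/
noncomputable def triMap (a b c : ℝ × ℝ) (x : ℝ × ℝ) : ℝ × ℝ := a + basisMap (b - a) (c - a) x

lemma triMap_fst (a b c x : ℝ × ℝ) :
    (triMap a b c x).1 = a.1 + (x.1 * (b.1 - a.1) + x.2 * (c.1 - a.1)) := by
  simp [triMap, basisMap_apply]

lemma triMap_snd (a b c x : ℝ × ℝ) :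
    (triMap a b c x).2 = a.2 + (x.1 * (b.2 - a.2) + x.2 * (c.2 - a.2)) := by
  simp [triMap, basisMap_apply]

lemma cross_triMap (a b c x y z : ℝ × ℝ) :
    cross (triMap a b c x) (triMap a b c y) (triMap a b c z) = cross a b c * cross x y z := by
  simp only [cross, triMap_fst, triMap_snd]; ring

lemma volume_triMap_image (a b c : ℝ × ℝ) (s : Set (ℝ × ℝ)) :
    volume (triMap a b c '' s) = ENNReal.ofReal |cross a b c| * volume s := by
  have : triMap a b c '' s = (fun x => a + x) '' (basisMap (b - a) (c - a) '' s) := by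
    rw [image_image]; rfl
  rw [this, image_add_left, measure_preimage_add, Measure.addHaar_image_linearMap, det_basisMap]
  simp [cross]

lemma triMap_injective {a b c : ℝ × ℝ} (h : cross a b c ≠ 0) :
    Function.Injective (triMap a b c) := by
  intro x y hxy
  have h1 := congrArg Prod.fst hxy
  have h2 := congrArg Prod.snd hxy
  rw [triMap_fst, triMap_fst] at h1
  rw [triMap_snd, triMap_snd] at h2
  have e1 : (x.1 - y.1) * cross a b c = 0 := by
    unfold cross; linear_combination (c.2 - a.2) * h1 - (c.1 - a.1) * h2
  have e2 : (x.2 - y.2) * cross a b c = 0 := by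
    unfold cross; linear_combination (b.1 - a.1) * h2 - (b.2 - a.2) * h1
  ext
  · linarith [(mul_eq_zero.1 e1).resolve_right h]
  · linarith [(mul_eq_zero.1 e2).resolve_right h]

lemma triMap_bary {a b c : ℝ × ℝ} (h : cross a b c ≠ 0) (p : ℝ × ℝ) :
    triMap a b c (cross a p c / cross a b c, cross a b p / cross a b c) = p := by
  have e : ∀ t : ℝ, t / cross a b c * cross a b c = t := fun t => div_mul_cancel₀ t h
  apply Prod.ext
  · rw [triMap_fst]; apply mul_right_cancel₀ h; simp only []
    rw [add_mul, add_mul, mul_right_comm, e, mul_right_comm (cross a b p / _), e]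
    unfold cross; ring
  · rw [triMap_snd]; apply mul_right_cancel₀ h; simp only []
    rw [add_mul, add_mul, mul_right_comm, e, mul_right_comm (cross a b p / _), e]
    unfold cross; ring

lemma lintegral_triMap_image {a b c : ℝ × ℝ} (h : cross a b c ≠ 0) {s : Set (ℝ × ℝ)}
    (hs : MeasurableSet s) (g : ℝ × ℝ → ℝ≥0∞) :
    ∫⁻ x in triMap a b c '' s, g x =
      ENNReal.ofReal |cross a b c| * ∫⁻ x in s, g (triMap a b c x) := by
  have hd : ∀ x ∈ s, HasFDerivWithinAt (triMap a b c)
      (LinearMap.toContinuousLinearMap (basisMap (b - a) (c - a))) s x := fun x _ =>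
    ((LinearMap.toContinuousLinearMap (basisMap (b - a) (c - a))).hasFDerivAt.const_add
      a).hasFDerivWithinAt
  rw [lintegral_image_eq_lintegral_abs_det_fderiv_mul volume hs hd
    (triMap_injective h).injOn, ← lintegral_const_mul' _ _ ENNReal.ofReal_ne_top]
  have : (LinearMap.toContinuousLinearMap (basisMap (b - a) (c - a))).det = cross a b c := by
    rw [ContinuousLinearMap.det, LinearMap.coe_toContinuousLinearMap, det_basisMap]; simp [cross]
  simp_rw [this]

lemma triInt_triMap_image {a b c : ℝ × ℝ} (h : cross a b c ≠ 0) {s : Set (ℝ × ℝ)}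
    (hs : MeasurableSet s) :
    triInt (triMap a b c '' s) = ENNReal.ofReal (|cross a b c| ^ 4) * triInt s := by
  unfold triInt
  simp_rw [lintegral_triMap_image h hs, triArea, cross_triMap, abs_mul, mul_div_assoc,
    ENNReal.ofReal_mul (abs_nonneg _), lintegral_const_mul' _ _ ENNReal.ofReal_ne_top]
  rw [ENNReal.ofReal_pow (abs_nonneg _)]
  ring

/-- The standard triangle. -/
def stdTri : Set (ℝ × ℝ) := {x | 0 ≤ x.1 ∧ 0 ≤ x.2 ∧ x.1 + x.2 ≤ 1}

lemma isClosed_stdTri : IsClosed stdTri := by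
  have h1 : IsClosed {x : ℝ × ℝ | 0 ≤ x.1} := isClosed_le (by fun_prop) (by fun_prop)
  have h2 : IsClosed {x : ℝ × ℝ | 0 ≤ x.2} := isClosed_le (by fun_prop) (by fun_prop)
  have h3 : IsClosed {x : ℝ × ℝ | x.1 + x.2 ≤ 1} := isClosed_le (by fun_prop) (by fun_prop)
  exact h1.inter (h2.inter h3)

lemma convexHull_triple (a b c : ℝ × ℝ) :
    convexHull ℝ {a, b, c} = triMap a b c '' stdTri := by
  ext p
  rw [convexHull_insert (by simp), convexHull_pair]
  simp only [mem_image, mem_convexJoin, segment_eq_image, mem_singleton_iff, stdTri, mem_ofPred_eq]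
  constructor
  · rintro ⟨_, rfl, _, ⟨t, ⟨ht0, ht1⟩, rfl⟩, s, ⟨hs0, hs1⟩, rfl⟩
    refine ⟨(s * (1 - t), s * t), ⟨by nlinarith, by positivity, by nlinarith⟩, ?_⟩
    simp only [triMap, basisMap_apply]; module
  · rintro ⟨⟨x, y⟩, ⟨hx, hy, hxy⟩, rfl⟩
    simp only at hx hy hxy
    rcases (add_nonneg hx hy).eq_or_lt with h0 | h0
    · have hx0 : x = 0 := by linarith
      have hy0 : y = 0 := by linarith
      refine ⟨a, rfl, b, ⟨0, by simp, by simp⟩, 0, by simp, ?_⟩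
      simp [triMap, basisMap_apply, hx0, hy0]
    · refine ⟨a, rfl, _, ⟨y / (x + y), ⟨by positivity, ?_⟩, rfl⟩, x + y, ⟨h0.le, hxy⟩, ?_⟩
      · rw [div_le_one h0]; linarith
      · simp only [triMap, basisMap_apply, smul_add, smul_smul]
        have e1 : (x + y) * (1 - y / (x + y)) = x := by field_simp; ring
        have e2 : (x + y) * (y / (x + y)) = y := by field_simp
        rw [e1, e2]; module

lemma volume_stdTri : volume stdTri = ENNReal.ofReal (1 / 2) := by
  rw [Measure.volume_eq_prod, Measure.prod_apply isClosed_stdTri.measurableSet]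
  have h1 : ∀ x : ℝ, volume (Prod.mk x ⁻¹' stdTri) =
      (Icc (0 : ℝ) 1).indicator (fun x => ENNReal.ofReal (1 - x)) x := by
    intro x
    by_cases hx : x ∈ Icc (0 : ℝ) 1
    · have : Prod.mk x ⁻¹' stdTri = Icc 0 (1 - x) := by
        ext y; simp only [stdTri, mem_preimage, mem_ofPred_eq, mem_Icc]
        constructor
        · rintro ⟨_, h, h'⟩; exact ⟨h, by linarith⟩
        · rintro ⟨h, h'⟩; exact ⟨hx.1, h, by linarith⟩
      rw [this, Real.volume_Icc, indicator_of_mem hx, sub_zero]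
    · have : Prod.mk x ⁻¹' stdTri = ∅ := by
        ext y; simp only [stdTri, mem_preimage, mem_ofPred_eq, mem_empty_iff_false, iff_false]
        rintro ⟨h, h', h''⟩; exact hx ⟨h, by linarith⟩
      rw [this, indicator_of_notMem hx, measure_empty]
  simp_rw [h1]
  rw [lintegral_indicator measurableSet_Icc, ← ofReal_integral_eq_lintegral_ofReal,
    integral_Icc_eq_integral_Ioc, ← intervalIntegral.integral_of_le zero_le_one]
  · rw [intervalIntegral.integral_sub (by simp) (by simp)]
    norm_num
  · exact (by fun_prop : Continuous fun x : ℝ => 1 - x).integrableOn_Icc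
  · filter_upwards [self_mem_ae_restrict measurableSet_Icc] with x hx
    simpa using hx.2

lemma volume_convexHull_triple (a b c : ℝ × ℝ) :
    volume (convexHull ℝ {a, b, c}) = ENNReal.ofReal (triArea a b c) := by
  rw [convexHull_triple, volume_triMap_image, volume_stdTri, ← ENNReal.ofReal_mul (abs_nonneg _),
    triArea]
  ring_nf

section Symmetrization

variable {α : Type*} [MeasurableSpace α] {μ : Measure α} [SFinite μ]

lemma lintegral_triple_swap_left {g : α → α → α → ℝ≥0∞}
    (hg : Measurable fun z : α × α × α => g z.1 z.2.1 z.2.2) :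
    ∫⁻ p, ∫⁻ q, ∫⁻ r, g q p r ∂μ ∂μ ∂μ = ∫⁻ p, ∫⁻ q, ∫⁻ r, g p q r ∂μ ∂μ ∂μ := by
  rw [lintegral_lintegral_swap]
  have h : Measurable fun z : (α × α) × α => g z.1.2 z.1.1 z.2 :=
    hg.comp (by fun_prop : Measurable fun z : (α × α) × α => (z.1.2, z.1.1, z.2))
  exact h.lintegral_prod_right'.aemeasurable

lemma lintegral_triple_swap_right {g : α → α → α → ℝ≥0∞}
    (hg : Measurable fun z : α × α × α => g z.1 z.2.1 z.2.2) :
    ∫⁻ p, ∫⁻ q, ∫⁻ r, g p r q ∂μ ∂μ ∂μ = ∫⁻ p, ∫⁻ q, ∫⁻ r, g p q r ∂μ ∂μ ∂μ := by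
  refine lintegral_congr fun p => ?_
  rw [lintegral_lintegral_swap]
  exact (hg.comp (by fun_prop : Measurable fun z : α × α => (p, z.2, z.1))).aemeasurable

/-- A symmetric integrand is controlled by its integral over triples whose third entry lies between
the first two. -/
lemma lintegral_triple_le_of_between {f : α → α → α → ℝ≥0∞} {h : α → ℝ} (hh : Measurable h)
    (hf : Measurable fun z : α × α × α => f z.1 z.2.1 z.2.2)
    (h1 : ∀ p q r, f p q r = f q p r) (h2 : ∀ p q r, f p q r = f p r q) :
    ∫⁻ p, ∫⁻ q, ∫⁻ r, f p q r ∂μ ∂μ ∂μ ≤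
      6 * ∫⁻ p, ∫⁻ q, ∫⁻ r, (if h p ≤ h r ∧ h r ≤ h q then f p q r else 0) ∂μ ∂μ ∂μ := by
  set g : α → α → α → ℝ≥0∞ := fun p q r => if h p ≤ h r ∧ h r ≤ h q then f p q r else 0 with hgdef
  have hg : Measurable fun z : α × α × α => g z.1 z.2.1 z.2.2 := by
    have s1 : MeasurableSet {z : α × α × α | h z.1 ≤ h z.2.2} :=
      measurableSet_le (by fun_prop) (by fun_prop)
    have s2 : MeasurableSet {z : α × α × α | h z.2.2 ≤ h z.2.1} :=
      measurableSet_le (by fun_prop) (by fun_prop)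
    exact Measurable.ite (s1.inter s2) hf measurable_const
  have m : ∀ φ : α × α × α → α × α × α, Measurable φ →
      Measurable fun z : α × α × α => g (φ z).1 (φ z).2.1 (φ z).2.2 := fun φ hφ => hg.comp hφ
  have m1 : Measurable fun z : α × α × α => g z.2.1 z.1 z.2.2 :=
    m (fun z => (z.2.1, z.1, z.2.2)) (by fun_prop)
  have m2 : Measurable fun z : α × α × α => g z.1 z.2.2 z.2.1 :=
    m (fun z => (z.1, z.2.2, z.2.1)) (by fun_prop)
  have m3 : Measurable fun z : α × α × α => g z.2.2 z.1 z.2.1 :=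
    m (fun z => (z.2.2, z.1, z.2.1)) (by fun_prop)
  have m4 : Measurable fun z : α × α × α => g z.2.1 z.2.2 z.1 :=
    m (fun z => (z.2.1, z.2.2, z.1)) (by fun_prop)
  have m5 : Measurable fun z : α × α × α => g z.2.2 z.2.1 z.1 :=
    m (fun z => (z.2.2, z.2.1, z.1)) (by fun_prop)
  set J := ∫⁻ p, ∫⁻ q, ∫⁻ r, g p q r ∂μ ∂μ ∂μ with hJ
  have j1 : ∫⁻ p, ∫⁻ q, ∫⁻ r, g q p r ∂μ ∂μ ∂μ = J := lintegral_triple_swap_left hg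
  have j2 : ∫⁻ p, ∫⁻ q, ∫⁻ r, g p r q ∂μ ∂μ ∂μ = J := lintegral_triple_swap_right hg
  have j3 : ∫⁻ p, ∫⁻ q, ∫⁻ r, g r p q ∂μ ∂μ ∂μ = J :=
    (lintegral_triple_swap_right (g := fun p q r => g q p r) m1).trans j1
  have j4 : ∫⁻ p, ∫⁻ q, ∫⁻ r, g q r p ∂μ ∂μ ∂μ = J :=
    (lintegral_triple_swap_left (g := fun p q r => g p r q) m2).trans j2
  have j5 : ∫⁻ p, ∫⁻ q, ∫⁻ r, g r q p ∂μ ∂μ ∂μ = J :=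
    (lintegral_triple_swap_left (g := fun p q r => g r p q) m3).trans j3
  have key : ∀ p q r, f p q r ≤
      g p q r + (g q p r + (g p r q + (g r p q + (g q r p + g r q p)))) := by
    intro p q r
    have le : ∀ x y z : α, h x ≤ h z → h z ≤ h y → g x y z = f x y z := fun x y z a b =>
      if_pos ⟨a, b⟩
    have e1 : f q p r = f p q r := (h1 _ _ _).symm
    have e2 : f p r q = f p q r := (h2 _ _ _).symm
    have e3 : f r p q = f p q r := by rw [h1, e2]
    have e4 : f q r p = f p q r := by rw [h2, e1]
    have e5 : f r q p = f p q r := by rw [h1, e4]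
    rcases le_total (h p) (h q) with a | a <;> rcases le_total (h q) (h r) with b | b <;>
      rcases le_total (h p) (h r) with c | c
    · rw [le p r q a b, e2]; exact le_add_left (le_add_left le_self_add)
    · rw [le p r q a b, e2]; exact le_add_left (le_add_left le_self_add)
    · rw [le p q r c b]; exact le_self_add
    · rw [le r q p c a, e5]; exact le_add_left (le_add_left (le_add_left (le_add_left le_add_self)))
    · rw [le q r p a c, e4]; exact le_add_left (le_add_left (le_add_left (le_add_left le_self_add)))
    · rw [le q p r b c, e1]; exact le_add_left le_self_add
    · rw [le r p q b a, e3]; exact le_add_left (le_add_left (le_add_left le_self_add))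
    · rw [le r p q b a, e3]; exact le_add_left (le_add_left (le_add_left le_self_add))
  calc ∫⁻ p, ∫⁻ q, ∫⁻ r, f p q r ∂μ ∂μ ∂μ
      ≤ ∫⁻ p, ∫⁻ q, ∫⁻ r,
        g p q r + (g q p r + (g p r q + (g r p q + (g q r p + g r q p)))) ∂μ ∂μ ∂μ :=
        lintegral_mono fun p => lintegral_mono fun q => lintegral_mono fun r => key p q r
    _ = J + (J + (J + (J + (J + J)))) := by
        have add : ∀ {a b : α → α → α → ℝ≥0∞},
            Measurable (fun z : α × α × α => a z.1 z.2.1 z.2.2) →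
            ∫⁻ p, ∫⁻ q, ∫⁻ r, a p q r + b p q r ∂μ ∂μ ∂μ =
            ∫⁻ p, ∫⁻ q, ∫⁻ r, a p q r ∂μ ∂μ ∂μ + ∫⁻ p, ∫⁻ q, ∫⁻ r, b p q r ∂μ ∂μ ∂μ := by
          intro a b ha
          have ha1 : ∀ p q, Measurable fun r => a p q r := fun p q =>
            ha.comp (by fun_prop : Measurable fun r : α => (p, q, r))
          have ha2' : Measurable fun z : α × α => ∫⁻ r, a z.1 z.2 r ∂μ :=
            (ha.comp (by fun_prop : Measurable fun z : (α × α) × α =>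
              (z.1.1, z.1.2, z.2))).lintegral_prod_right'
          have ha2 : ∀ p, Measurable fun q => ∫⁻ r, a p q r ∂μ := fun p =>
            ha2'.comp (by fun_prop : Measurable fun q : α => (p, q))
          simp_rw [lintegral_add_left (ha1 _ _), lintegral_add_left (ha2 _)]
          rw [lintegral_add_left ha2'.lintegral_prod_right']
        rw [add hg, add m1, add m2, add m3, add m4, j1, j2, j3, j4, j5]
    _ = 6 * J := by ring

end Symmetrization

lemma lintegral_Icc_of_polynomial {a b : ℝ} (hab : a ≤ b) {g : ℝ → ℝ} (G : Polynomial ℝ)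
    (hg : ∀ x, g x = G.derivative.eval x) (h0 : ∀ x ∈ Icc a b, 0 ≤ g x) :
    ∫⁻ x in Icc a b, ENNReal.ofReal (g x) = ENNReal.ofReal (G.eval b - G.eval a) := by
  have hc : Continuous g := by
    rw [show g = fun x => G.derivative.eval x from funext hg]; exact Polynomial.continuous _
  rw [← ofReal_integral_eq_lintegral_ofReal hc.integrableOn_Icc,
    integral_Icc_eq_integral_Ioc, ← intervalIntegral.integral_of_le hab,
    intervalIntegral.integral_eq_sub_of_hasDerivAt (f := fun x => G.eval x)]
  · intro x _; rw [hg]; exact G.hasDerivAt x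
  · exact hc.intervalIntegrable _ _
  · filter_upwards [self_mem_ae_restrict measurableSet_Icc] with x hx using h0 x hx

lemma measurableSet_strip (u v : ℝ) : MeasurableSet {p : ℝ × ℝ | u ≤ p.1 ∧ p.1 ≤ v} :=
  (measurableSet_Icc (a := u) (b := v)).preimage measurable_fst

lemma lintegral_stdTri_strip {u v : ℝ} (hu : 0 ≤ u) {h : ℝ × ℝ → ℝ≥0∞}
    (hh : Measurable h) :
    ∫⁻ p in stdTri ∩ {p | u ≤ p.1 ∧ p.1 ≤ v}, h p =
      ∫⁻ x in Icc u v, ∫⁻ y in Icc 0 (1 - x), h (x, y) := by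
  have hs : MeasurableSet (stdTri ∩ {p : ℝ × ℝ | u ≤ p.1 ∧ p.1 ≤ v}) :=
    isClosed_stdTri.measurableSet.inter (measurableSet_strip u v)
  rw [← lintegral_indicator hs, Measure.volume_eq_prod, lintegral_prod _
    (hh.indicator hs).aemeasurable, ← lintegral_indicator measurableSet_Icc]
  refine lintegral_congr fun x => ?_
  by_cases hx : x ∈ Icc u v
  · rw [indicator_of_mem hx, ← lintegral_indicator measurableSet_Icc]
    refine lintegral_congr fun y => ?_
    by_cases hy : y ∈ Icc 0 (1 - x)
    · rw [indicator_of_mem hy, indicator_of_mem]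
      exact ⟨⟨hu.trans hx.1, hy.1, by linarith [hy.2]⟩, hx⟩
    · rw [indicator_of_notMem hy, indicator_of_notMem]
      rintro ⟨⟨_, h1, h2⟩, _⟩
      exact hy ⟨h1, by simp only at h2; linarith⟩
  · rw [indicator_of_notMem hx]
    refine (lintegral_congr fun y => ?_).trans lintegral_zero
    rw [indicator_of_notMem]
    exact fun h' => hx h'.2


lemma lintegral_abs_sub_le {b L k : ℝ} (hk : 0 ≤ k) (h0 : 0 ≤ L) (hL : L ≤ b) :
    ∫⁻ y in Icc 0 b, ENNReal.ofReal (k * |y - L|) ≤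
      ENNReal.ofReal (k * (b ^ 2 / 2 - b * L + L ^ 2)) := by
  rw [← Icc_union_Icc_eq_Icc h0 hL]
  refine (lintegral_union_le _ _ _).trans ?_
  have e1 : ∫⁻ y in Icc 0 L, ENNReal.ofReal (k * |y - L|) =
      ∫⁻ y in Icc 0 L, ENNReal.ofReal (k * (L - y)) :=
    setLIntegral_congr_fun measurableSet_Icc fun y hy => by
      rw [abs_sub_comm, abs_of_nonneg (by linarith [hy.2])]
  have e2 : ∫⁻ y in Icc L b, ENNReal.ofReal (k * |y - L|) =
      ∫⁻ y in Icc L b, ENNReal.ofReal (k * (y - L)) :=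
    setLIntegral_congr_fun measurableSet_Icc fun y hy => by
      rw [abs_of_nonneg (by linarith [hy.1])]
  rw [e1, e2, lintegral_Icc_of_polynomial h0 (.C (k * L) * .X - .C (k / 2) * .X ^ 2) ?_
      fun y hy => mul_nonneg hk (by linarith [hy.2]),
    lintegral_Icc_of_polynomial hL (.C (k / 2) * .X ^ 2 - .C (k * L) * .X) ?_
      fun y hy => mul_nonneg hk (by linarith [hy.1]), ← ENNReal.ofReal_add]
  · apply ENNReal.ofReal_le_ofReal; apply le_of_eq; simp; ring
  · simp; nlinarith [mul_nonneg hk (sq_nonneg L)]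
  · simp; nlinarith [mul_nonneg hk (sq_nonneg (b - L))]
  · intro x
    simp only [Polynomial.derivative_add, Polynomial.derivative_sub, Polynomial.derivative_mul,
      Polynomial.derivative_neg, Polynomial.derivative_C, Polynomial.derivative_X,
      Polynomial.derivative_one, Polynomial.derivative_pow, Polynomial.eval_add,
      Polynomial.eval_sub, Polynomial.eval_mul, Polynomial.eval_neg, Polynomial.eval_C,
      Polynomial.eval_X, Polynomial.eval_one, Polynomial.eval_zero, Polynomial.eval_pow]
    push_cast; ring
  · intro x
    simp only [Polynomial.derivative_add, Polynomial.derivative_sub, Polynomial.derivative_mul,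
      Polynomial.derivative_neg, Polynomial.derivative_C, Polynomial.derivative_X,
      Polynomial.derivative_one, Polynomial.derivative_pow, Polynomial.eval_add,
      Polynomial.eval_sub, Polynomial.eval_mul, Polynomial.eval_neg, Polynomial.eval_C,
      Polynomial.eval_X, Polynomial.eval_one, Polynomial.eval_zero, Polynomial.eval_pow]
    push_cast; ring

lemma lintegral_middle_le {x₁ y₁ x₃ y₃ : ℝ} (h : x₁ ≤ x₃) (hy₁ : y₁ ∈ Icc 0 (1 - x₁))
    (hy₃ : y₃ ∈ Icc 0 (1 - x₃)) :
    ∫⁻ x in Icc x₁ x₃, ∫⁻ y in Icc 0 (1 - x),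
      ENNReal.ofReal (triArea (x₁, y₁) (x₃, y₃) (x, y)) ≤
    ENNReal.ofReal ((x₃ - x₁) ^ 2 / 2 *
      (((1 - x₁) ^ 2 + (1 - x₁) * (1 - x₃) + (1 - x₃) ^ 2) / 6
        - ((2 * (1 - x₁) + (1 - x₃)) * y₁ + ((1 - x₁) + 2 * (1 - x₃)) * y₃) / 6
        + (y₁ ^ 2 + y₁ * y₃ + y₃ ^ 2) / 3)) := by
  rcases h.eq_or_lt with rfl | h
  · simp
  have hw : 0 < x₃ - x₁ := sub_pos.2 h
  obtain ⟨m, hm⟩ : ∃ m, y₃ = y₁ + m * (x₃ - x₁) := ⟨(y₃ - y₁) / (x₃ - x₁), by field_simp; ring⟩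
  have step : ∀ x ∈ Icc x₁ x₃, ∫⁻ y in Icc 0 (1 - x),
      ENNReal.ofReal (triArea (x₁, y₁) (x₃, y₃) (x, y)) ≤
      ENNReal.ofReal ((x₃ - x₁) / 2 * ((1 - x) ^ 2 / 2 - (1 - x) * (y₁ + m * (x - x₁)) +
        (y₁ + m * (x - x₁)) ^ 2)) := by
    intro x hx
    refine le_trans (le_of_eq ?_) (lintegral_abs_sub_le (by linarith) ?_ ?_)
    · refine lintegral_congr fun y => ?_
      congr 1
      have : cross (x₁, y₁) (x₃, y₃) (x, y) = (x₃ - x₁) * (y - (y₁ + m * (x - x₁))) := by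
        simp only [cross, hm]; ring
      rw [triArea, this, abs_mul, abs_of_pos hw]; ring
    · apply nonneg_of_mul_nonneg_right _ hw
      have : (x₃ - x₁) * (y₁ + m * (x - x₁)) = (x₃ - x) * y₁ + (x - x₁) * y₃ := by rw [hm]; ring
      rw [this]
      exact add_nonneg (mul_nonneg (by linarith [hx.2]) hy₁.1)
        (mul_nonneg (by linarith [hx.1]) hy₃.1)
    · apply le_of_mul_le_mul_left _ hw
      have : (x₃ - x₁) * (y₁ + m * (x - x₁)) = (x₃ - x) * y₁ + (x - x₁) * y₃ := by rw [hm]; ring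
      rw [this]
      nlinarith [mul_le_mul_of_nonneg_left hy₁.2 (sub_nonneg.2 hx.2),
        mul_le_mul_of_nonneg_left hy₃.2 (sub_nonneg.2 hx.1)]
  refine (setLIntegral_mono' measurableSet_Icc step).trans ?_
  rw [lintegral_Icc_of_polynomial h.le
    (.C ((x₃ - x₁) / 2) * (-.C (1 / 6) * (1 - .X) ^ 3
      - (.C (y₁ - m * x₁) * .X + .C ((m - (y₁ - m * x₁)) / 2) * .X ^ 2 - .C (m / 3) * .X ^ 3)
      + (.C ((y₁ - m * x₁) ^ 2) * .X + .C (m * (y₁ - m * x₁)) * .X ^ 2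
        + .C (m ^ 2 / 3) * .X ^ 3)))]
  · apply ENNReal.ofReal_le_ofReal
    apply le_of_eq
    simp only [hm, Polynomial.eval_add, Polynomial.eval_sub, Polynomial.eval_mul,
      Polynomial.eval_neg, Polynomial.eval_C, Polynomial.eval_X, Polynomial.eval_one,
      Polynomial.eval_pow]
    ring
  · intro x
    simp only [Polynomial.derivative_add, Polynomial.derivative_sub, Polynomial.derivative_mul,
      Polynomial.derivative_neg, Polynomial.derivative_C, Polynomial.derivative_X,
      Polynomial.derivative_one, Polynomial.derivative_pow, Polynomial.eval_add,
      Polynomial.eval_sub, Polynomial.eval_mul, Polynomial.eval_neg, Polynomial.eval_C,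
      Polynomial.eval_X, Polynomial.eval_one, Polynomial.eval_zero, Polynomial.eval_pow]
    push_cast; ring
  · intro x _
    apply mul_nonneg (by linarith)
    nlinarith [sq_nonneg ((1 - x) / 2 - (y₁ + m * (x - x₁))), sq_nonneg (1 - x)]

lemma lintegral_last_fiber {x₁ y₁ x₃ : ℝ} (h₃ : x₃ ≤ 1) :
    ∫⁻ y₃ in Icc 0 (1 - x₃), ENNReal.ofReal ((x₃ - x₁) ^ 2 / 2 *
      (((1 - x₁) ^ 2 + (1 - x₁) * (1 - x₃) + (1 - x₃) ^ 2) / 6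
        - ((2 * (1 - x₁) + (1 - x₃)) * y₁ + ((1 - x₁) + 2 * (1 - x₃)) * y₃) / 6
        + (y₁ ^ 2 + y₁ * y₃ + y₃ ^ 2) / 3)) =
    ENNReal.ofReal ((x₃ - x₁) ^ 2 / 2 * ((1 - x₃) * (1 - x₁) ^ 2 / 6
      + (1 - x₁) * (1 - x₃) ^ 2 / 12 + (1 - x₃) ^ 3 / 9 - (1 - x₁) * (1 - x₃) * y₁ / 3
      + (1 - x₃) * y₁ ^ 2 / 3)) := by
  rw [lintegral_Icc_of_polynomial (by linarith) (.C ((x₃ - x₁) ^ 2 / 2) *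
    (.C (((1 - x₁) ^ 2 + (1 - x₁) * (1 - x₃) + (1 - x₃) ^ 2) / 6
      - (2 * (1 - x₁) + (1 - x₃)) * y₁ / 6 + y₁ ^ 2 / 3) * .X
      + .C (-((1 - x₁) + 2 * (1 - x₃)) / 12 + y₁ / 6) * .X ^ 2 + .C (1 / 9) * .X ^ 3))]
  · congr 1
    simp only [Polynomial.eval_add, Polynomial.eval_sub, Polynomial.eval_mul,
      Polynomial.eval_neg, Polynomial.eval_C, Polynomial.eval_X, Polynomial.eval_one,
      Polynomial.eval_pow]
    ring
  · intro x
    simp only [Polynomial.derivative_add, Polynomial.derivative_sub, Polynomial.derivative_mul,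
      Polynomial.derivative_neg, Polynomial.derivative_C, Polynomial.derivative_X,
      Polynomial.derivative_one, Polynomial.derivative_pow, Polynomial.eval_add,
      Polynomial.eval_sub, Polynomial.eval_mul, Polynomial.eval_neg, Polynomial.eval_C,
      Polynomial.eval_X, Polynomial.eval_one, Polynomial.eval_zero, Polynomial.eval_pow]
    push_cast; ring
  · intro y _
    apply mul_nonneg (by positivity)
    nlinarith [sq_nonneg (((1 - x₁) / 2 - y₁) + ((1 - x₃) / 2 - y)),
      sq_nonneg ((1 - x₁) / 2 - y₁), sq_nonneg ((1 - x₃) / 2 - y),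
      sq_nonneg ((1 - x₁) + (1 - x₃)), sq_nonneg (1 - x₁), sq_nonneg (1 - x₃)]

lemma lintegral_last_base {x₁ y₁ : ℝ} (h₁ : x₁ ≤ 1) :
    ∫⁻ x₃ in Icc x₁ 1, ENNReal.ofReal ((x₃ - x₁) ^ 2 / 2 * ((1 - x₃) * (1 - x₁) ^ 2 / 6
      + (1 - x₁) * (1 - x₃) ^ 2 / 12 + (1 - x₃) ^ 3 / 9 - (1 - x₁) * (1 - x₃) * y₁ / 3
      + (1 - x₃) * y₁ ^ 2 / 3)) =
    ENNReal.ofReal ((1 - x₁) ^ 4 * ((1 - x₁) ^ 2 / 6 - (1 - x₁) * y₁ / 3 + y₁ ^ 2 / 3) / 24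
      + (1 - x₁) ^ 6 / 432) := by
  rw [lintegral_Icc_of_polynomial h₁ (-.C (1 / 2) *
    (.C ((1 - x₁) ^ 2 / 6 - (1 - x₁) * y₁ / 3 + y₁ ^ 2 / 3) *
      (.C ((1 - x₁) ^ 2 / 2) * (1 - .X) ^ 2 - .C (2 * (1 - x₁) / 3) * (1 - .X) ^ 3
        + .C (1 / 4) * (1 - .X) ^ 4)
    + .C ((1 - x₁) / 12) * (.C ((1 - x₁) ^ 2 / 3) * (1 - .X) ^ 3 - .C ((1 - x₁) / 2) * (1 - .X) ^ 4
        + .C (1 / 5) * (1 - .X) ^ 5)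
    + .C (1 / 9) * (.C ((1 - x₁) ^ 2 / 4) * (1 - .X) ^ 4 - .C (2 * (1 - x₁) / 5) * (1 - .X) ^ 5
        + .C (1 / 6) * (1 - .X) ^ 6)))]
  · congr 1
    simp only [Polynomial.eval_add, Polynomial.eval_sub, Polynomial.eval_mul,
      Polynomial.eval_neg, Polynomial.eval_C, Polynomial.eval_X, Polynomial.eval_one,
      Polynomial.eval_pow]
    ring
  · intro x
    simp only [Polynomial.derivative_add, Polynomial.derivative_sub, Polynomial.derivative_mul,
      Polynomial.derivative_neg, Polynomial.derivative_C, Polynomial.derivative_X,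
      Polynomial.derivative_one, Polynomial.derivative_pow, Polynomial.eval_add,
      Polynomial.eval_sub, Polynomial.eval_mul, Polynomial.eval_neg, Polynomial.eval_C,
      Polynomial.eval_X, Polynomial.eval_one, Polynomial.eval_zero, Polynomial.eval_pow]
    push_cast; ring
  · intro x hx
    apply mul_nonneg (by positivity)
    have hc : 0 ≤ 1 - x := by linarith [hx.2]
    have ha : 0 ≤ 1 - x₁ := by linarith
    have e : 0 ≤ (1 - x) * (((1 - x₁) / 2 - y₁) ^ 2 + ((1 - x₁) / 2) ^ 2) := by positivity
    have e1 : 0 ≤ (1 - x₁) * (1 - x) ^ 2 := by positivity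
    have e2 : 0 ≤ (1 - x) ^ 3 := by positivity
    nlinarith

lemma lintegral_first_fiber {x₁ : ℝ} (h₁ : x₁ ≤ 1) :
    ∫⁻ y₁ in Icc 0 (1 - x₁), ENNReal.ofReal ((1 - x₁) ^ 4 *
      ((1 - x₁) ^ 2 / 6 - (1 - x₁) * y₁ / 3 + y₁ ^ 2 / 3) / 24 + (1 - x₁) ^ 6 / 432) =
    ENNReal.ofReal ((1 - x₁) ^ 7 / 144) := by
  rw [lintegral_Icc_of_polynomial (by linarith) (.C ((1 - x₁) ^ 4 / 24) *
    (.C ((1 - x₁) ^ 2 / 6) * .X - .C ((1 - x₁) / 6) * .X ^ 2 + .C (1 / 9) * .X ^ 3)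
    + .C ((1 - x₁) ^ 6 / 432) * .X)]
  · congr 1
    simp only [Polynomial.eval_add, Polynomial.eval_sub, Polynomial.eval_mul,
      Polynomial.eval_neg, Polynomial.eval_C, Polynomial.eval_X, Polynomial.eval_one,
      Polynomial.eval_pow]
    ring
  · intro x
    simp only [Polynomial.derivative_add, Polynomial.derivative_sub, Polynomial.derivative_mul,
      Polynomial.derivative_neg, Polynomial.derivative_C, Polynomial.derivative_X,
      Polynomial.derivative_one, Polynomial.derivative_pow, Polynomial.eval_add,
      Polynomial.eval_sub, Polynomial.eval_mul, Polynomial.eval_neg, Polynomial.eval_C,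
      Polynomial.eval_X, Polynomial.eval_one, Polynomial.eval_zero, Polynomial.eval_pow]
    push_cast; ring
  · intro y _
    have e : 0 ≤ (1 - x₁) ^ 4 * (((1 - x₁) / 2 - y) ^ 2 + ((1 - x₁) / 2) ^ 2) := by positivity
    have e1 : 0 ≤ (1 - x₁) ^ 6 := by positivity
    nlinarith

lemma triInt_stdTri_le : triInt stdTri ≤ ENNReal.ofReal (1 / 192) := by
  have hK := isClosed_stdTri.measurableSet
  have hf : Measurable fun z : (ℝ × ℝ) × (ℝ × ℝ) × (ℝ × ℝ) =>
      ENNReal.ofReal (triArea z.1 z.2.1 z.2.2) := by fun_prop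
  have hswap : ∀ p q r, ENNReal.ofReal (triArea p q r) = ENNReal.ofReal (triArea p r q) := by
    intro p q r; rw [triArea_swap p q, triArea_rotate q p r]
  refine (lintegral_triple_le_of_between (measurable_fst (α := ℝ) (β := ℝ)) hf
    (fun p q r => by rw [triArea_swap]) hswap).trans ?_
  have inner : ∀ p ∈ stdTri, ∫⁻ q in stdTri, ∫⁻ r in stdTri,
      (if p.1 ≤ r.1 ∧ r.1 ≤ q.1 then ENNReal.ofReal (triArea p q r) else 0) ≤
      ENNReal.ofReal ((1 - p.1) ^ 4 * ((1 - p.1) ^ 2 / 6 - (1 - p.1) * p.2 / 3 + p.2 ^ 2 / 3) / 24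
        + (1 - p.1) ^ 6 / 432) := by
    rintro ⟨x₁, y₁⟩ ⟨hx₁, hy₁, hxy₁⟩
    simp only at hx₁ hy₁ hxy₁ ⊢
    have mid : ∀ q ∈ stdTri, ∫⁻ r in stdTri,
        (if x₁ ≤ r.1 ∧ r.1 ≤ q.1 then ENNReal.ofReal (triArea (x₁, y₁) q r) else 0) ≤
        {p : ℝ × ℝ | x₁ ≤ p.1 ∧ p.1 ≤ 1}.indicator (fun q => ENNReal.ofReal ((q.1 - x₁) ^ 2 / 2 *
          (((1 - x₁) ^ 2 + (1 - x₁) * (1 - q.1) + (1 - q.1) ^ 2) / 6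
          - ((2 * (1 - x₁) + (1 - q.1)) * y₁ + ((1 - x₁) + 2 * (1 - q.1)) * q.2) / 6
          + (y₁ ^ 2 + y₁ * q.2 + q.2 ^ 2) / 3))) q := by
      rintro ⟨x₃, y₃⟩ ⟨hx₃, hy₃, hxy₃⟩
      simp only at hx₃ hy₃ hxy₃
      have e : ∀ r : ℝ × ℝ, (if x₁ ≤ r.1 ∧ r.1 ≤ x₃ then
          ENNReal.ofReal (triArea (x₁, y₁) (x₃, y₃) r) else 0) =
          {p : ℝ × ℝ | x₁ ≤ p.1 ∧ p.1 ≤ x₃}.indicator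
            (fun r => ENNReal.ofReal (triArea (x₁, y₁) (x₃, y₃) r)) r := fun r => by
        simp only [indicator, mem_ofPred_eq]
      simp_rw [e]
      rw [lintegral_indicator (measurableSet_strip _ _),
        Measure.restrict_restrict (measurableSet_strip _ _), inter_comm,
        lintegral_stdTri_strip hx₁ (by fun_prop)]
      by_cases h : x₁ ≤ x₃
      · rw [indicator_of_mem (show (x₃, y₃) ∈ {p : ℝ × ℝ | x₁ ≤ p.1 ∧ p.1 ≤ 1} from
          ⟨h, by simp only; linarith⟩)]
        exact lintegral_middle_le h ⟨hy₁, by linarith⟩ ⟨hy₃, by linarith⟩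
      · rw [Icc_eq_empty h]; simp
    refine (setLIntegral_mono' hK mid).trans ?_
    rw [lintegral_indicator (measurableSet_strip _ _),
        Measure.restrict_restrict (measurableSet_strip _ _), inter_comm,
        lintegral_stdTri_strip hx₁ (by fun_prop), ← lintegral_last_base (by linarith)]
    exact (setLIntegral_congr_fun measurableSet_Icc
      fun x₃ hx₃ => lintegral_last_fiber hx₃.2).le
  refine (mul_le_mul_right (setLIntegral_mono' hK inner) _).trans ?_
  have hsub : stdTri = stdTri ∩ {p : ℝ × ℝ | 0 ≤ p.1 ∧ p.1 ≤ 1} := by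
    refine (inter_eq_left.2 ?_).symm
    rintro p ⟨hx, hy, hxy⟩
    exact ⟨hx, by linarith⟩
  rw [hsub, lintegral_stdTri_strip le_rfl (by fun_prop),
    setLIntegral_congr_fun measurableSet_Icc fun x₁ hx₁ => lintegral_first_fiber hx₁.2,
    lintegral_Icc_of_polynomial zero_le_one (-.C (1 / 1152) * (1 - .X) ^ 8)]
  · rw [show (6 : ℝ≥0∞) = ENNReal.ofReal 6 by simp, ← ENNReal.ofReal_mul (by norm_num)]
    apply ENNReal.ofReal_le_ofReal
    simp; norm_num
  · intro x
    simp only [Polynomial.derivative_add, Polynomial.derivative_sub, Polynomial.derivative_mul,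
      Polynomial.derivative_neg, Polynomial.derivative_C, Polynomial.derivative_X,
      Polynomial.derivative_one, Polynomial.derivative_pow, Polynomial.eval_add,
      Polynomial.eval_sub, Polynomial.eval_mul, Polynomial.eval_neg, Polynomial.eval_C,
      Polynomial.eval_X, Polynomial.eval_one, Polynomial.eval_zero, Polynomial.eval_pow]
    push_cast; ring
  · intro x hx
    have : 0 ≤ 1 - x := by linarith [hx.2]
    positivity

lemma triInt_triMap_stdTri_le {a b c : ℝ × ℝ} (h : cross a b c ≠ 0) :
    triInt (triMap a b c '' stdTri) ≤ ENNReal.ofReal (triArea a b c ^ 4 / 12) := by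
  rw [triInt_triMap_image h isClosed_stdTri.measurableSet]
  refine (mul_le_mul_right triInt_stdTri_le _).trans ?_
  rw [← ENNReal.ofReal_mul (by positivity), triArea]
  apply ENNReal.ofReal_le_ofReal
  apply le_of_eq; ring

/-- The set obtained from `K` by sliding its vertical sections down to the horizontal axis. -/
def shake (K : Set (ℝ × ℝ)) : Set (ℝ × ℝ) :=
  {p | ∃ u w, (p.1, u) ∈ K ∧ (p.1, w) ∈ K ∧ 0 ≤ p.2 ∧ p.2 ≤ w - u}

/-- The lower end of the vertical section of `K` at abscissa `x`. -/
noncomputable def lower (K : Set (ℝ × ℝ)) (x : ℝ) : ℝ := sInf {y | (x, y) ∈ K}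

/-- The upper end of the vertical section of `K` at abscissa `x`. -/
noncomputable def upper (K : Set (ℝ × ℝ)) (x : ℝ) : ℝ := sSup {y | (x, y) ∈ K}

variable {K : Set (ℝ × ℝ)}

lemma isCompact_section (hK : IsCompact K) (x : ℝ) : IsCompact {y | (x, y) ∈ K} := by
  have : {y | (x, y) ∈ K} = Prod.snd '' (K ∩ {p | p.1 = x}) := by
    ext y; constructor
    · intro h; exact ⟨(x, y), ⟨h, rfl⟩, rfl⟩
    · rintro ⟨⟨x', y'⟩, ⟨h, h'⟩, rfl⟩
      have h'' : x' = x := h'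
      subst h''; exact h
  have hc : IsClosed {p : ℝ × ℝ | p.1 = x} := isClosed_eq continuous_fst continuous_const
  rw [this]
  exact (hK.inter_right hc).image continuous_snd

lemma lower_le (hK : IsCompact K) {p : ℝ × ℝ} (hp : p ∈ K) : lower K p.1 ≤ p.2 :=
  csInf_le (isCompact_section hK p.1).bddBelow hp

lemma le_upper (hK : IsCompact K) {p : ℝ × ℝ} (hp : p ∈ K) : p.2 ≤ upper K p.1 :=
  le_csSup (isCompact_section hK p.1).bddAbove hp

lemma lower_mem (hK : IsCompact K) {x : ℝ} (hx : x ∈ Prod.fst '' K) : (x, lower K x) ∈ K := by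
  obtain ⟨p, hp, rfl⟩ := hx
  exact (isCompact_section hK p.1).sInf_mem ⟨p.2, hp⟩

lemma upper_mem (hK : IsCompact K) {x : ℝ} (hx : x ∈ Prod.fst '' K) : (x, upper K x) ∈ K := by
  obtain ⟨p, hp, rfl⟩ := hx
  exact (isCompact_section hK p.1).sSup_mem ⟨p.2, hp⟩

lemma mem_iff_lower_upper (hK : IsCompact K) (hc : Convex ℝ K) {p : ℝ × ℝ} :
    p ∈ K ↔ p.1 ∈ Prod.fst '' K ∧ lower K p.1 ≤ p.2 ∧ p.2 ≤ upper K p.1 := by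
  refine ⟨fun h => ⟨⟨p, h, rfl⟩, lower_le hK h, le_upper hK h⟩, ?_⟩
  rintro ⟨h, h1, h2⟩
  have hs : Convex ℝ {y | (p.1, y) ∈ K} := by
    intro y hy z hz a b ha hb hab
    have := hc hy hz ha hb hab
    have e : a • (p.1, y) + b • (p.1, z) = (p.1, a • y + b • z) := by
      ext
      · simp [← add_mul, hab]
      · simp
    rwa [e] at this
  exact hs.ordConnected.out (lower_mem hK h) (upper_mem hK h) ⟨h1, h2⟩

lemma mem_shake_iff (hK : IsCompact K) {p : ℝ × ℝ} :
    p ∈ shake K ↔ p.1 ∈ Prod.fst '' K ∧ 0 ≤ p.2 ∧ p.2 ≤ upper K p.1 - lower K p.1 := by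
  constructor
  · rintro ⟨u, w, hu, hw, h0, h1⟩
    exact ⟨⟨_, hu, rfl⟩, h0, by linarith [lower_le hK hu, le_upper hK hw]⟩
  · rintro ⟨h, h0, h1⟩
    exact ⟨_, _, lower_mem hK h, upper_mem hK h, h0, h1⟩

lemma convex_shake (hc : Convex ℝ K) : Convex ℝ (shake K) := by
  rintro p ⟨u, w, hu, hw, h0, h1⟩ q ⟨u', w', hu', hw', h0', h1'⟩ a b ha hb hab
  refine ⟨_, _, hc hu hu' ha hb hab, hc hw hw' ha hb hab, ?_, ?_⟩
  · simp only [Prod.snd_add, Prod.smul_snd, smul_eq_mul]; positivity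
  · simp only [Prod.snd_add, Prod.smul_snd, smul_eq_mul]
    nlinarith [mul_le_mul_of_nonneg_left h1 ha, mul_le_mul_of_nonneg_left h1' hb]

lemma isCompact_shake (hK : IsCompact K) : IsCompact (shake K) := by
  have hcl : IsClosed {z : (ℝ × ℝ) × (ℝ × ℝ) × ℝ | z.1.1 = z.2.1.1} :=
    isClosed_eq (by fun_prop) (by fun_prop)
  have hcl' : IsClosed {z : (ℝ × ℝ) × (ℝ × ℝ) × ℝ | z.1.2 ≤ z.2.1.2} :=
    isClosed_le (by fun_prop) (by fun_prop)
  have : shake K = (fun z : (ℝ × ℝ) × (ℝ × ℝ) × ℝ => (z.1.1, z.2.2 * (z.2.1.2 - z.1.2))) ''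
      ((K ×ˢ K ×ˢ Icc (0 : ℝ) 1) ∩ ({z | z.1.1 = z.2.1.1} ∩ {z | z.1.2 ≤ z.2.1.2})) := by
    ext ⟨x, y⟩
    constructor
    · rintro ⟨u, w, hu, hw, h0, h1⟩
      simp only at hu hw h0 h1
      rcases (h0.trans h1).eq_or_lt with h | h
      · exact ⟨((x, u), (x, w), 0), ⟨⟨hu, hw, by simp⟩, rfl, by simp only [mem_ofPred_eq]; linarith⟩,
          by simp; linarith⟩
      · refine ⟨((x, u), (x, w), y / (w - u)), ⟨⟨hu, hw, by positivity, (div_le_one h).2 h1⟩, rfl,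
          by simp only [mem_ofPred_eq]; linarith⟩, ?_⟩
        simp [div_mul_cancel₀ _ h.ne']
    · rintro ⟨⟨⟨x1, u⟩, ⟨x2, w⟩, t⟩, ⟨⟨hu, hw, ht0, ht1⟩, h, h'⟩, he⟩
      simp only [Prod.mk.injEq, mem_ofPred_eq] at he h h' hu hw ht0 ht1
      obtain ⟨rfl, rfl⟩ := he
      subst h
      exact ⟨u, w, hu, hw, mul_nonneg ht0 (by linarith), by simp only; nlinarith⟩
  rw [this]
  exact ((hK.prod (hK.prod isCompact_Icc)).inter_right (hcl.inter hcl')).image (by fun_prop)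

lemma measurable_lower (hK : IsCompact K) : Measurable (lower K) := by
  refine measurable_of_Iic fun c => ?_
  have hcl : IsClosed {p : ℝ × ℝ | p.2 ≤ c} := isClosed_le (by fun_prop) (by fun_prop)
  have : lower K ⁻¹' Iic c =
      Prod.fst '' (K ∩ {p | p.2 ≤ c}) ∪ ((Prod.fst '' K)ᶜ ∩ {_x | (0 : ℝ) ≤ c}) := by
    ext x
    by_cases hx : x ∈ Prod.fst '' K
    · constructor
      · intro h; exact Or.inl ⟨_, ⟨lower_mem hK hx, h⟩, rfl⟩
      · rintro (⟨p, ⟨hp, hpc⟩, rfl⟩ | h)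
        · exact (lower_le hK hp).trans hpc
        · exact (h.1 hx).elim
    · have h0 : lower K x = 0 := by
        have : {y | (x, y) ∈ K} = ∅ := by
          ext y; simp only [mem_ofPred_eq, mem_empty_iff_false, iff_false]
          exact fun h => hx ⟨_, h, rfl⟩
        rw [lower, this, Real.sInf_empty]
      rw [mem_preimage, h0]
      constructor
      · intro h; exact Or.inr ⟨hx, h⟩
      · rintro (⟨p, ⟨hp, -⟩, rfl⟩ | h)
        · exact (hx ⟨p, hp, rfl⟩).elim
        · exact h.2
  rw [this]
  exact ((hK.inter_right hcl).image continuous_fst).measurableSet.union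
    ((hK.image continuous_fst).measurableSet.compl.inter (MeasurableSet.const _))

lemma measurable_upper (hK : IsCompact K) : Measurable (upper K) := by
  refine measurable_of_Ici fun c => ?_
  have hcl : IsClosed {p : ℝ × ℝ | c ≤ p.2} := isClosed_le (by fun_prop) (by fun_prop)
  have : upper K ⁻¹' Ici c =
      Prod.fst '' (K ∩ {p | c ≤ p.2}) ∪ ((Prod.fst '' K)ᶜ ∩ {_x | c ≤ (0 : ℝ)}) := by
    ext x
    by_cases hx : x ∈ Prod.fst '' K
    · constructor
      · intro h; exact Or.inl ⟨_, ⟨upper_mem hK hx, h⟩, rfl⟩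
      · rintro (⟨p, ⟨hp, hpc⟩, rfl⟩ | h)
        · exact hpc.trans (le_upper hK hp)
        · exact (h.1 hx).elim
    · have h0 : upper K x = 0 := by
        have : {y | (x, y) ∈ K} = ∅ := by
          ext y; simp only [mem_ofPred_eq, mem_empty_iff_false, iff_false]
          exact fun h => hx ⟨_, h, rfl⟩
        rw [upper, this, Real.sSup_empty]
      rw [mem_preimage, h0]
      constructor
      · intro h; exact Or.inr ⟨hx, h⟩
      · rintro (⟨p, ⟨hp, -⟩, rfl⟩ | h)
        · exact (hx ⟨p, hp, rfl⟩).elim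
        · exact h.2
  rw [this]
  exact ((hK.inter_right hcl).image continuous_fst).measurableSet.union
    ((hK.image continuous_fst).measurableSet.compl.inter (MeasurableSet.const _))

lemma measurePreserving_shear {f : ℝ → ℝ} (hf : Measurable f) :
    MeasurePreserving (fun p : ℝ × ℝ => (p.1, f p.1 + p.2)) volume volume :=
  (MeasurePreserving.id volume).skew_product (g := fun x y => f x + y) (by fun_prop)
    (Filter.Eventually.of_forall fun x => map_add_left_eq_self volume (f x))

lemma measurePreserving_reflect {f : ℝ → ℝ} (hf : Measurable f) :
    MeasurePreserving (fun p : ℝ × ℝ => (p.1, f p.1 - p.2)) volume volume :=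
  (MeasurePreserving.id volume).skew_product (g := fun x y => f x - y) (by fun_prop)
    (Filter.Eventually.of_forall fun x => Measure.map_sub_left_eq_self volume (f x))

lemma preimage_shear_lower (hK : IsCompact K) (hc : Convex ℝ K) :
    (fun p : ℝ × ℝ => (p.1, lower K p.1 + p.2)) ⁻¹' K = shake K := by
  ext p
  rw [mem_preimage, mem_iff_lower_upper hK hc, mem_shake_iff hK]
  simp only [le_add_iff_nonneg_right]
  refine and_congr_right fun _ => and_congr_right fun _ => ?_
  constructor <;> intro h <;> linarith

lemma preimage_reflect_shake (hK : IsCompact K) :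
    (fun p : ℝ × ℝ => (p.1, (upper K p.1 - lower K p.1) - p.2)) ⁻¹' shake K = shake K := by
  ext p
  rw [mem_preimage, mem_shake_iff hK, mem_shake_iff hK]
  refine and_congr_right fun _ => ?_
  constructor <;> rintro ⟨h, h'⟩ <;> simp only at h h' ⊢ <;> constructor <;> linarith

lemma volume_shake (hK : IsCompact K) (hc : Convex ℝ K) : volume (shake K) = volume K := by
  rw [← preimage_shear_lower hK hc]
  exact (measurePreserving_shear (measurable_lower hK)).measure_preimage
    hK.measurableSet.nullMeasurableSet

lemma triInt_preimage {f : ℝ × ℝ → ℝ × ℝ} (hf : MeasurePreserving f volume volume)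
    (hK : MeasurableSet K) :
    triInt K = ∫⁻ z in (f ⁻¹' K) ×ˢ (f ⁻¹' K) ×ˢ (f ⁻¹' K),
      ENNReal.ofReal (triArea (f z.1) (f z.2.1) (f z.2.2)) := by
  have hp : MeasurePreserving (Prod.map f (Prod.map f f)) volume volume := hf.prod (hf.prod hf)
  have hm : Measurable fun z : (ℝ × ℝ) × (ℝ × ℝ) × (ℝ × ℝ) =>
      ENNReal.ofReal (triArea z.1 z.2.1 z.2.2) := by fun_prop
  rw [triInt_eq_prod, ← hp.setLIntegral_comp_preimage (hK.prod (hK.prod hK)) hm]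
  rfl

lemma lower_convex (hK : IsCompact K) (hc : Convex ℝ K) {p q r : ℝ × ℝ} (hp : p ∈ K) (hr : r ∈ K)
    (h1 : p.1 ≤ q.1) (h2 : q.1 ≤ r.1) :
    lower K q.1 * (r.1 - p.1) ≤ lower K p.1 * (r.1 - q.1) + lower K r.1 * (q.1 - p.1) := by
  rcases (h1.trans h2).eq_or_lt with h | h
  · have e : q.1 = r.1 := by linarith
    rw [h, e]; simp
  have hd : 0 < r.1 - p.1 := by linarith
  have := hc (lower_mem hK ⟨p, hp, rfl⟩) (lower_mem hK ⟨r, hr, rfl⟩)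
    (a := (r.1 - q.1) / (r.1 - p.1)) (b := (q.1 - p.1) / (r.1 - p.1))
    (div_nonneg (by linarith) hd.le) (div_nonneg (by linarith) hd.le) (by field_simp; ring)
  have h3 := lower_le hK this
  have e : (r.1 - q.1) / (r.1 - p.1) * p.1 + (q.1 - p.1) / (r.1 - p.1) * r.1 = q.1 := by
    field_simp; ring
  simp only [Prod.smul_mk, Prod.mk_add_mk, smul_eq_mul, e] at h3
  calc _ ≤ _ := mul_le_mul_of_nonneg_right h3 hd.le
    _ = _ := by field_simp

lemma upper_concave (hK : IsCompact K) (hc : Convex ℝ K) {p q r : ℝ × ℝ} (hp : p ∈ K) (hr : r ∈ K)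
    (h1 : p.1 ≤ q.1) (h2 : q.1 ≤ r.1) :
    upper K p.1 * (r.1 - q.1) + upper K r.1 * (q.1 - p.1) ≤ upper K q.1 * (r.1 - p.1) := by
  rcases (h1.trans h2).eq_or_lt with h | h
  · have e : q.1 = r.1 := by linarith
    rw [h, e]; simp
  have hd : 0 < r.1 - p.1 := by linarith
  have := hc (upper_mem hK ⟨p, hp, rfl⟩) (upper_mem hK ⟨r, hr, rfl⟩)
    (a := (r.1 - q.1) / (r.1 - p.1)) (b := (q.1 - p.1) / (r.1 - p.1))
    (div_nonneg (by linarith) hd.le) (div_nonneg (by linarith) hd.le) (by field_simp; ring)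
  have h3 := le_upper hK this
  have e : (r.1 - q.1) / (r.1 - p.1) * p.1 + (q.1 - p.1) / (r.1 - p.1) * r.1 = q.1 := by
    field_simp; ring
  simp only [Prod.smul_mk, Prod.mk_add_mk, smul_eq_mul, e] at h3
  calc _ = _ := by field_simp
    _ ≤ _ := mul_le_mul_of_nonneg_right h3 hd.le

lemma abs_add_abs_le_of_opposite {A B Y : ℝ} (h : A ≤ 0 ∧ 0 ≤ B ∨ 0 ≤ A ∧ B ≤ 0) :
    |A + Y| + |B - Y| ≤ |Y| + |B - A - Y| := by
  rcases h with h | h <;> rcases abs_cases (A + Y) with h1 | h1 <;>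
    rcases abs_cases (B - Y) with h2 | h2 <;> rcases abs_cases Y with h3 | h3 <;>
    rcases abs_cases (B - A - Y) with h4 | h4 <;> linarith [h.1, h.2]

lemma triArea_shear_add_le (hK : IsCompact K) (hc : Convex ℝ K) {p q r : ℝ × ℝ}
    (hp : p.1 ∈ Prod.fst '' K) (hq : q.1 ∈ Prod.fst '' K) (hr : r.1 ∈ Prod.fst '' K) :
    triArea (p.1, lower K p.1 + p.2) (q.1, lower K q.1 + q.2) (r.1, lower K r.1 + r.2) +
      triArea (p.1, lower K p.1 + (upper K p.1 - lower K p.1 - p.2))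
        (q.1, lower K q.1 + (upper K q.1 - lower K q.1 - q.2))
        (r.1, lower K r.1 + (upper K r.1 - lower K r.1 - r.2)) ≤
    triArea p q r +
      triArea (p.1, upper K p.1 - lower K p.1 - p.2) (q.1, upper K q.1 - lower K q.1 - q.2)
        (r.1, upper K r.1 - lower K r.1 - r.2) := by
  set A := lower K p.1 * (r.1 - q.1) + lower K q.1 * (p.1 - r.1) + lower K r.1 * (q.1 - p.1)
  set B := upper K p.1 * (r.1 - q.1) + upper K q.1 * (p.1 - r.1) + upper K r.1 * (q.1 - p.1)
  set Y := p.2 * (r.1 - q.1) + q.2 * (p.1 - r.1) + r.2 * (q.1 - p.1)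
  have hAB : A ≤ 0 ∧ 0 ≤ B ∨ 0 ≤ A ∧ B ≤ 0 := by
    obtain ⟨p', hp', ep⟩ := hp
    obtain ⟨q', hq', eq⟩ := hq
    obtain ⟨r', hr', er⟩ := hr
    simp only [A, B, ← ep, ← eq, ← er]
    have sorted : ∀ {u v w : ℝ × ℝ}, u ∈ K → w ∈ K → u.1 ≤ v.1 → v.1 ≤ w.1 →
        lower K v.1 * (w.1 - u.1) ≤ lower K u.1 * (w.1 - v.1) + lower K w.1 * (v.1 - u.1) ∧
        upper K u.1 * (w.1 - v.1) + upper K w.1 * (v.1 - u.1) ≤ upper K v.1 * (w.1 - u.1) :=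
      fun hu hw h1 h2 => ⟨lower_convex hK hc hu hw h1 h2, upper_concave hK hc hu hw h1 h2⟩
    rcases le_total p'.1 q'.1 with h1 | h1 <;> rcases le_total q'.1 r'.1 with h2 | h2 <;>
      rcases le_total p'.1 r'.1 with h3 | h3
    · right; constructor <;> linarith [(sorted hp' hr' h1 h2).1, (sorted hp' hr' h1 h2).2]
    · right; constructor <;> linarith [(sorted hp' hr' h1 h2).1, (sorted hp' hr' h1 h2).2]
    · left; constructor <;> linarith [(sorted hp' hq' h3 h2).1, (sorted hp' hq' h3 h2).2]
    · right; constructor <;> linarith [(sorted hr' hq' h3 h1).1, (sorted hr' hq' h3 h1).2]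
    · left; constructor <;> linarith [(sorted hq' hr' h1 h3).1, (sorted hq' hr' h1 h3).2]
    · right; constructor <;> linarith [(sorted hq' hp' h2 h3).1, (sorted hq' hp' h2 h3).2]
    · left; constructor <;> linarith [(sorted hr' hp' h2 h1).1, (sorted hr' hp' h2 h1).2]
    · left; constructor <;> linarith [(sorted hr' hp' h2 h1).1, (sorted hr' hp' h2 h1).2]
  have key := abs_add_abs_le_of_opposite (Y := Y) hAB
  have e1 : cross (p.1, lower K p.1 + p.2) (q.1, lower K q.1 + q.2) (r.1, lower K r.1 + r.2)
    = A + Y := by simp only [cross, A, Y]; ring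
  have e2 : cross (p.1, lower K p.1 + (upper K p.1 - lower K p.1 - p.2))
        (q.1, lower K q.1 + (upper K q.1 - lower K q.1 - q.2))
        (r.1, lower K r.1 + (upper K r.1 - lower K r.1 - r.2)) = B - Y := by
    simp only [cross, B, Y]; ring
  have e3 : cross p q r = Y := by simp only [cross, Y]; ring
  have e4 : cross (p.1, upper K p.1 - lower K p.1 - p.2) (q.1, upper K q.1 - lower K q.1 - q.2)
        (r.1, upper K r.1 - lower K r.1 - r.2) = B - A - Y := by
    simp only [cross, A, B, Y]; ring
  simp only [triArea, e1, e2, e3, e4]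
  linarith

/-- Shaking a convex set down does not decrease the mean area of a random triangle. -/
lemma triInt_le_triInt_shake (hK : IsCompact K) (hc : Convex ℝ K) :
    triInt K ≤ triInt (shake K) := by
  have hl := measurable_lower hK
  have hu := measurable_upper hK
  have hτ := measurePreserving_shear hl
  have hρ := measurePreserving_reflect (hu.sub hl)
  have hS := (isCompact_shake hK).measurableSet
  have e1 := triInt_preimage hτ hK.measurableSet
  have e2 := triInt_preimage (hτ.comp hρ) hK.measurableSet
  have e3 := triInt_eq_prod (shake K)
  have e4 := triInt_preimage hρ hS
  rw [preimage_comp, preimage_shear_lower hK hc] at e2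
  rw [preimage_shear_lower hK hc] at e1
  simp only [Pi.sub_apply] at e2 e4
  rw [preimage_reflect_shake hK] at e2 e4
  have h2 : 2 * triInt K ≤ 2 * triInt (shake K) := by
    rw [two_mul, two_mul]
    nth_rewrite 1 [e1]
    nth_rewrite 1 [e2]
    nth_rewrite 1 [e3]
    nth_rewrite 1 [e4]
    rw [← lintegral_add_left (by fun_prop), ← lintegral_add_left (by fun_prop)]
    refine setLIntegral_mono' (hS.prod (hS.prod hS)) ?_
    rintro ⟨p, q, r⟩ ⟨hp, hq, hr⟩
    rw [← ENNReal.ofReal_add (triArea_nonneg _ _ _) (triArea_nonneg _ _ _),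
      ← ENNReal.ofReal_add (triArea_nonneg _ _ _) (triArea_nonneg _ _ _)]
    exact ENNReal.ofReal_le_ofReal (triArea_shear_add_le hK hc ((mem_shake_iff hK).1 hp).1
      ((mem_shake_iff hK).1 hq).1 ((mem_shake_iff hK).1 hr).1)
  exact (ENNReal.mul_le_mul_iff_right (by norm_num) (by norm_num)).1 h2

lemma triMap_combo (a b c x y : ℝ × ℝ) {s t : ℝ} (h : s + t = 1) :
    triMap a b c (s • x + t • y) = s • triMap a b c x + t • triMap a b c y := by
  ext
  · simp only [triMap_fst, Prod.fst_add, Prod.snd_add, Prod.smul_fst, Prod.smul_snd, smul_eq_mul]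
    linear_combination -a.1 * h
  · simp only [triMap_snd, Prod.fst_add, Prod.snd_add, Prod.smul_fst, Prod.smul_snd, smul_eq_mul]
    linear_combination -a.2 * h

lemma convex_triMap_image (a b c : ℝ × ℝ) (hc : Convex ℝ K) : Convex ℝ (triMap a b c '' K) := by
  rintro _ ⟨x, hx, rfl⟩ _ ⟨y, hy, rfl⟩ s t hs ht hst
  exact ⟨_, hc hx hy hs ht hst, triMap_combo a b c x y hst⟩

lemma continuous_triMap (a b c : ℝ × ℝ) : Continuous (triMap a b c) := by
  unfold triMap
  exact continuous_const.add (LinearMap.continuous_of_finiteDimensional _)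

lemma image_preimage_triMap {a b c : ℝ × ℝ} (h : cross a b c ≠ 0) (K : Set (ℝ × ℝ)) :
    triMap a b c '' (triMap a b c ⁻¹' K) = K :=
  image_preimage_eq _ fun p => ⟨_, triMap_bary h p⟩

lemma isCompact_triMap_preimage {a b c : ℝ × ℝ} (h : cross a b c ≠ 0) (hK : IsCompact K) :
    IsCompact (triMap a b c ⁻¹' K) := by
  have : triMap a b c ⁻¹' K =
      (fun p => (cross a p c / cross a b c, cross a b p / cross a b c)) '' K := by
    ext p
    constructor
    · intro hp
      exact ⟨_, hp, triMap_injective h (triMap_bary h _)⟩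
    · rintro ⟨q, hq, rfl⟩
      rwa [mem_preimage, triMap_bary h]
  rw [this]
  refine hK.image ?_
  unfold cross; fun_prop

lemma convex_triMap_preimage (a b c : ℝ × ℝ) (hc : Convex ℝ K) :
    Convex ℝ (triMap a b c ⁻¹' K) := by
  intro x hx y hy s t hs ht hst
  rw [mem_preimage, triMap_combo a b c x y hst]
  exact hc hx hy hs ht hst

lemma zero_mem_triMap_preimage {a b c : ℝ × ℝ} (ha : a ∈ K) : (0, 0) ∈ triMap a b c ⁻¹' K := by
  rw [mem_preimage]; convert ha using 1; ext <;> simp [triMap_fst, triMap_snd]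

lemma fst_mem_triMap_preimage {a b c : ℝ × ℝ} (hb : b ∈ K) : (1, 0) ∈ triMap a b c ⁻¹' K := by
  rw [mem_preimage]; convert hb using 1; ext <;> simp [triMap_fst, triMap_snd]

lemma snd_mem_triMap_preimage {a b c : ℝ × ℝ} (hc : c ∈ K) : (0, 1) ∈ triMap a b c ⁻¹' K := by
  rw [mem_preimage]; convert hc using 1; ext <;> simp [triMap_fst, triMap_snd]

/-- Shaking along the side `a c` of a triangle produces a larger triangle if the set extends
beyond that side. -/
lemma exists_shaken_of_beyond (hK : IsCompact K) (hconv : Convex ℝ K) {a b c z : ℝ × ℝ}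
    (ha : a ∈ K) (hb : b ∈ K) (hc : c ∈ K) (hz : z ∈ K) (h : cross a b c ≠ 0) {t : ℝ}
    (ht : t ≤ -(cross a z c / cross a b c)) :
    ∃ K', IsCompact K' ∧ Convex ℝ K' ∧ volume K' = volume K ∧ triInt K ≤ triInt K' ∧
      ∃ p ∈ K', ∃ q ∈ K', ∃ r ∈ K', triArea a b c * (1 + t) ≤ triArea p q r := by
  set K₀ := triMap a b c ⁻¹' K with hK₀
  have hc₀ : IsCompact K₀ := isCompact_triMap_preimage h hK
  have hv₀ : Convex ℝ K₀ := convex_triMap_preimage a b c hconv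
  have him : triMap a b c '' K₀ = K := image_preimage_triMap h K
  have m0 : (0, 0) ∈ K₀ := zero_mem_triMap_preimage ha
  have m1 : (1, 0) ∈ K₀ := fst_mem_triMap_preimage hb
  have m2 : (0, 1) ∈ K₀ := snd_mem_triMap_preimage hc
  have mz : (cross a z c / cross a b c, cross a b z / cross a b c) ∈ K₀ := by
    rwa [hK₀, mem_preimage, triMap_bary h]
  refine ⟨triMap a b c '' shake K₀, (isCompact_shake hc₀).image (continuous_triMap a b c),
    convex_triMap_image a b c (convex_shake hv₀), ?_, ?_, _,
    mem_image_of_mem _ (x := (cross a z c / cross a b c, 0)) ⟨_, _, mz, mz, le_rfl, by simp⟩, _,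
    mem_image_of_mem _ (x := (1, 0)) ⟨_, _, m1, m1, le_rfl, by simp⟩, _,
    mem_image_of_mem _ (x := (0, 1)) ⟨_, _, m0, m2, zero_le_one, by simp⟩, ?_⟩
  · rw [volume_triMap_image, volume_shake hc₀ hv₀, ← volume_triMap_image, him]
  · nth_rewrite 1 [← him]
    rw [triInt_triMap_image h hc₀.measurableSet,
      triInt_triMap_image h (isCompact_shake hc₀).measurableSet]
    gcongr
    exact triInt_le_triInt_shake hc₀ hv₀
  · rw [triArea, triArea, cross_triMap, abs_mul, mul_div_right_comm]
    refine mul_le_mul_of_nonneg_left ?_ (by positivity)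
    refine le_trans ?_ (le_abs_self _)
    simp only [cross] at ht ⊢
    linarith

lemma volume_le_of_max_triangle {K : Set (ℝ × ℝ)} {r s t : ℝ} (hr : 0 ≤ r) (hs : 0 ≤ s) (ht : 0 ≤ t)
    (h1 : ∀ p ∈ K, |p.1| ≤ 1) (h2 : ∀ p ∈ K, |p.2| ≤ 1) (h3 : ∀ p ∈ K, |1 - p.1 - p.2| ≤ 1)
    (hr' : ∀ p ∈ K, -r ≤ p.1) (hs' : ∀ p ∈ K, -s ≤ p.2) (ht' : ∀ p ∈ K, -t ≤ 1 - p.1 - p.2) :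
    volume K ≤ ENNReal.ofReal (1 / 2 + (r + s + t)) := by
  have hsub : K ⊆ stdTri ∪ (Icc (-r) 0 ×ˢ Icc 0 1 ∪ (Icc 0 1 ×ˢ Icc (-s) 0 ∪
      (fun p : ℝ × ℝ => (p.1, (p.1 - 1) + p.2)) ⁻¹' (Icc 0 1 ×ˢ Icc 0 t))) := by
    intro p hp
    have a1 := abs_le.1 (h1 p hp)
    have a2 := abs_le.1 (h2 p hp)
    have a3 := abs_le.1 (h3 p hp)
    have a4 := hr' p hp
    have a5 := hs' p hp
    have a6 := ht' p hp
    by_cases c1 : p.1 ≤ 0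
    · exact Or.inr (Or.inl ⟨⟨a4, c1⟩, by linarith, by linarith⟩)
    by_cases c2 : p.2 ≤ 0
    · exact Or.inr (Or.inr (Or.inl ⟨⟨by linarith, by linarith⟩, a5, c2⟩))
    by_cases c3 : p.1 + p.2 ≤ 1
    · exact Or.inl ⟨by linarith, by linarith, c3⟩
    · refine Or.inr (Or.inr (Or.inr ⟨⟨?_, ?_⟩, ?_, ?_⟩)) <;> simp only <;> linarith
  refine (measure_mono hsub).trans ?_
  refine (measure_union_le _ _).trans ?_
  refine (add_le_add_right ((measure_union_le _ _).trans
    (add_le_add_right (measure_union_le _ _) _)) _).trans (le_of_eq ?_)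
  have e := (measurePreserving_shear (f := fun x => x - 1) (by fun_prop)).measure_preimage
    ((measurableSet_Icc (a := (0 : ℝ)) (b := 1)).prod
      (measurableSet_Icc (a := (0 : ℝ)) (b := t))).nullMeasurableSet
  rw [e, volume_stdTri, Measure.volume_eq_prod, Measure.prod_prod, Measure.prod_prod,
    Measure.prod_prod]
  simp only [Real.volume_Icc]
  rw [← ENNReal.ofReal_mul (by linarith), ← ENNReal.ofReal_mul (by linarith),
    ← ENNReal.ofReal_mul (by linarith), ← ENNReal.ofReal_add, ← ENNReal.ofReal_add,
    ← ENNReal.ofReal_add] <;> first | positivity | skip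
  · congr 1; ring
  all_goals simp; try positivity

lemma cross_rotate (p q r : ℝ × ℝ) : cross p q r = cross q r p := by unfold cross; ring

/-- A convex set with a largest inscribed triangle can be rearranged, keeping its area and
increasing `triInt`, so that it contains a definitely larger triangle. -/
lemma exists_larger_triangle (hK : IsCompact K) (hconv : Convex ℝ K) {a b c : ℝ × ℝ}
    (ha : a ∈ K) (hb : b ∈ K) (hc : c ∈ K) (h : cross a b c ≠ 0)
    (hmax : ∀ p ∈ K, ∀ q ∈ K, ∀ r ∈ K, triArea p q r ≤ triArea a b c) :
    ∃ K', IsCompact K' ∧ Convex ℝ K' ∧ volume K' = volume K ∧ triInt K ≤ triInt K' ∧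
      ∃ p ∈ K', ∃ q ∈ K', ∃ r ∈ K',
        triArea a b c + (volume.real K - triArea a b c) / 6 ≤ triArea p q r := by
  have hne : K.Nonempty := ⟨a, ha⟩
  have hco : ∀ {f : ℝ × ℝ → ℝ}, Continuous f → ∃ z ∈ K, ∀ p ∈ K, f z ≤ f p := fun hf =>
    (hK.exists_isMinOn hne hf.continuousOn)
  obtain ⟨x, hx, hx'⟩ := hco (f := fun p => cross a p c / cross a b c) (by unfold cross; fun_prop)
  obtain ⟨y, hy, hy'⟩ := hco (f := fun p => cross b p a / cross b c a) (by unfold cross; fun_prop)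
  obtain ⟨z, hz, hz'⟩ := hco (f := fun p => cross c p b / cross c a b) (by unfold cross; fun_prop)
  have hS : triArea a b c = |cross a b c| / 2 := rfl
  have hS0 : 0 < |cross a b c| := abs_pos.2 h
  have hle : ∀ p ∈ K, ∀ q ∈ K, ∀ r ∈ K, |cross p q r / cross a b c| ≤ 1 := fun p hp q hq r hr => by
    rw [abs_div, div_le_one hS0]
    have := hmax p hp q hq r hr
    rw [triArea, triArea] at this; linarith
  have rb : cross b c a = cross a b c := (cross_rotate a b c).symm
  have rc : cross c a b = cross a b c := cross_rotate c a b
  have hvol : volume K ≤ ENNReal.ofReal |cross a b c| * ENNReal.ofReal (1 / 2 +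
      (-(cross a x c / cross a b c) + -(cross b y a / cross b c a) +
        -(cross c z b / cross c a b))) := by
    conv_lhs => rw [← image_preimage_triMap h K]
    rw [volume_triMap_image]
    gcongr
    have key : ∀ p ∈ triMap a b c ⁻¹' K, cross a (triMap a b c p) c / cross a b c = p.1 ∧
        cross b (triMap a b c p) a / cross a b c = p.2 ∧
        cross c (triMap a b c p) b / cross a b c = 1 - p.1 - p.2 := fun p _ => by
      refine ⟨?_, ?_, ?_⟩ <;> rw [div_eq_iff h] <;> simp only [cross, triMap_fst, triMap_snd] <;>
        ring
    have z1 : cross a a c = 0 := by unfold cross; ring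
    have z2 : cross b a a = 0 := by unfold cross; ring
    have z3 : cross c b b = 0 := by unfold cross; ring
    apply volume_le_of_max_triangle
    · simpa [z1] using hx' a ha
    · simpa [z2] using hy' a ha
    · simpa [z3] using hz' b hb
    · intro p hp; rw [← (key p hp).1]; exact hle _ ha _ hp _ hc
    · intro p hp; rw [← (key p hp).2.1]; exact hle _ hb _ hp _ ha
    · intro p hp; rw [← (key p hp).2.2]; exact hle _ hc _ hp _ hb
    · intro p hp; rw [← (key p hp).1, neg_neg]; exact hx' _ hp
    · intro p hp; rw [← (key p hp).2.1, neg_neg]; simpa only [rb] using hy' _ hp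
    · intro p hp; rw [← (key p hp).2.2, neg_neg]; simpa only [rc] using hz' _ hp
  set X := -(cross a x c / cross a b c) with hX
  set Y := -(cross b y a / cross b c a) with hY
  set Z := -(cross c z b / cross c a b) with hZ
  have hX0 : 0 ≤ X := by
    have z1 : cross a a c = 0 := by unfold cross; ring
    simpa [z1, hX] using hx' a ha
  have hY0 : 0 ≤ Y := by
    have z2 : cross b a a = 0 := by unfold cross; ring
    simpa [z2, hY] using hy' a ha
  have hZ0 : 0 ≤ Z := by
    have z3 : cross c b b = 0 := by unfold cross; ring
    simpa [z3, hZ] using hz' b hb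
  have hV : volume.real K ≤ |cross a b c| * (1 / 2 + (X + Y + Z)) := by
    rw [← ENNReal.ofReal_mul (abs_nonneg _)] at hvol
    exact ENNReal.toReal_le_of_le_ofReal (by positivity) hvol
  set t := (volume.real K / |cross a b c| - 1 / 2) / 3 with ht
  have hts : triArea a b c + (volume.real K - triArea a b c) / 6 = triArea a b c * (1 + t) := by
    rw [ht, hS]; field_simp; ring
  have hsum : 3 * t ≤ X + Y + Z := by
    rw [ht]
    have : volume.real K / |cross a b c| ≤ 1 / 2 + (X + Y + Z) := by
      rw [div_le_iff₀ hS0]; linarith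
    linarith
  rw [hts]
  by_cases c1 : t ≤ X
  · exact exists_shaken_of_beyond hK hconv ha hb hc hx h c1
  by_cases c2 : t ≤ Y
  · rw [triArea_rotate a b c]
    exact exists_shaken_of_beyond hK hconv hb hc ha hy (by rwa [rb]) c2
  · rw [← triArea_rotate c a b]
    exact exists_shaken_of_beyond hK hconv hc ha hb hz (by rwa [rc]) (by linarith)

lemma exists_max_triangle (hK : IsCompact K) (hne : K.Nonempty) :
    ∃ a ∈ K, ∃ b ∈ K, ∃ c ∈ K, ∀ p ∈ K, ∀ q ∈ K, ∀ r ∈ K, triArea p q r ≤ triArea a b c := by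
  obtain ⟨⟨a, b, c⟩, ⟨ha, hb, hc⟩, h⟩ := (hK.prod (hK.prod hK)).exists_isMaxOn
    (hne.prod (hne.prod hne)) (f := fun z => triArea z.1 z.2.1 z.2.2)
    (by fun_prop : Continuous fun z : (ℝ × ℝ) × (ℝ × ℝ) × (ℝ × ℝ) =>
      triArea z.1 z.2.1 z.2.2).continuousOn
  exact ⟨a, ha, b, hb, c, hc, fun p hp q hq r hr => h (a := (p, q, r)) ⟨hp, hq, hr⟩⟩

lemma triArea_le_volume (hK : IsCompact K) (hconv : Convex ℝ K) {a b c : ℝ × ℝ}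
    (ha : a ∈ K) (hb : b ∈ K) (hc : c ∈ K) : triArea a b c ≤ volume.real K := by
  have hT : convexHull ℝ {a, b, c} ⊆ K := convexHull_min (by
    rintro p (rfl | rfl | rfl) <;> assumption) hconv
  have := measure_mono (μ := volume) hT
  rw [volume_convexHull_triple] at this
  exact (ENNReal.ofReal_le_iff_le_toReal hK.measure_lt_top.ne).1 this

lemma triInt_le_of_max_triangle (hK : IsCompact K) (hconv : Convex ℝ K) {a b c : ℝ × ℝ}
    (ha : a ∈ K) (hb : b ∈ K) (hc : c ∈ K) (h : cross a b c ≠ 0)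
    (hmax : ∀ p ∈ K, ∀ q ∈ K, ∀ r ∈ K, triArea p q r ≤ triArea a b c) :
    triInt K ≤ ENNReal.ofReal (triArea a b c ^ 4 / 12 +
      triArea a b c * (volume.real K ^ 3 - triArea a b c ^ 3)) := by
  set T := convexHull ℝ {a, b, c} with hTdef
  have hT : T ⊆ K := convexHull_min (by rintro p (rfl | rfl | rfl) <;> assumption) hconv
  have hTm : MeasurableSet T := ((Set.toFinite {a, b, c}).isCompact_convexHull ℝ).measurableSet
  have hT3 : T ×ˢ T ×ˢ T ⊆ K ×ˢ K ×ˢ K := prod_mono hT (prod_mono hT hT)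
  have hTm3 := hTm.prod (hTm.prod hTm)
  have hKm3 := hK.measurableSet.prod (hK.measurableSet.prod hK.measurableSet)
  have hS := triArea_nonneg a b c
  have hle := triArea_le_volume hK hconv ha hb hc
  have hTfin : volume (T ×ˢ T ×ˢ T) ≠ ∞ := by
    rw [volume_prod_triple, hTdef, volume_convexHull_triple]; finiteness
  rw [triInt_eq_prod, ← union_sdiff_cancel hT3, lintegral_union (hKm3.diff hTm3) disjoint_sdiff_right,
    ENNReal.ofReal_add (by positivity)
      (mul_nonneg hS (sub_nonneg.2 (pow_le_pow_left₀ hS hle 3)))]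
  refine add_le_add ?_ ?_
  · rw [← triInt_eq_prod, hTdef, convexHull_triple]
    exact triInt_triMap_stdTri_le h
  · have hb : ∀ z ∈ (K ×ˢ K ×ˢ K) \ (T ×ˢ T ×ˢ T), ENNReal.ofReal (triArea z.1 z.2.1 z.2.2) ≤
        ENNReal.ofReal (triArea a b c) := fun z hz =>
      ENNReal.ofReal_le_ofReal (hmax _ hz.1.1 _ hz.1.2.1 _ hz.1.2.2)
    refine (setLIntegral_mono' (hKm3.diff hTm3) hb).trans ?_
    rw [setLIntegral_const, measure_sdiff hT3 hTm3.nullMeasurableSet hTfin, volume_prod_triple,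
      volume_prod_triple, hTdef, volume_convexHull_triple,
      ← ENNReal.ofReal_toReal hK.measure_lt_top.ne, ENNReal.ofReal_mul hS]
    gcongr
    rw [← ENNReal.ofReal_mul (by positivity), ← ENNReal.ofReal_mul (by positivity),
      ← ENNReal.ofReal_mul (by positivity), ← ENNReal.ofReal_mul (by positivity),
      ← ENNReal.ofReal_sub _ (by positivity)]
    apply ENNReal.ofReal_le_ofReal
    apply le_of_eq; rw [Measure.real]; ring

lemma triInt_le_add_geometric (n : ℕ) : ∀ K : Set (ℝ × ℝ), IsCompact K → Convex ℝ K →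
    ∀ a ∈ K, ∀ b ∈ K, ∀ c ∈ K, cross a b c ≠ 0 →
    (∀ p ∈ K, ∀ q ∈ K, ∀ r ∈ K, triArea p q r ≤ triArea a b c) →
    triInt K ≤ ENNReal.ofReal (volume.real K ^ 4 / 12 +
      3 * volume.real K ^ 3 * (5 / 6) ^ n * (volume.real K - triArea a b c)) := by
  induction n with
  | zero =>
    intro K hK hconv a ha b hb c hc h hmax
    refine (triInt_le_of_max_triangle hK hconv ha hb hc h hmax).trans
      (ENNReal.ofReal_le_ofReal ?_)
    have hS := triArea_nonneg a b c
    have hle := triArea_le_volume hK hconv ha hb hc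
    set S := triArea a b c
    set V := volume.real K
    have h1 : S ^ 4 ≤ V ^ 4 := pow_le_pow_left₀ hS hle 4
    have h2 : S * (V ^ 2 + V * S + S ^ 2) ≤ V * (V ^ 2 + V * V + V ^ 2) := by
      have hV := hS.trans hle
      gcongr
    nlinarith [mul_le_mul_of_nonneg_right h2 (sub_nonneg.2 hle)]
  | succ n ih =>
    intro K hK hconv a ha b hb c hc h hmax
    obtain ⟨K', hK', hconv', hvol, h_int, p, hp, q, hq, r, hr, hpqr⟩ :=
      exists_larger_triangle hK hconv ha hb hc h hmax
    obtain ⟨a', ha', b', hb', c', hc', hmax'⟩ := exists_max_triangle hK' ⟨p, hp⟩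
    have hge := hpqr.trans (hmax' p hp q hq r hr)
    have hle := triArea_le_volume hK hconv ha hb hc
    have hS : 0 < triArea a b c := by
      have := abs_pos.2 h; unfold triArea; positivity
    have h' : cross a' b' c' ≠ 0 := by
      intro h0
      have : triArea a' b' c' = 0 := by rw [triArea, h0]; simp
      linarith
    have hV : volume.real K' = volume.real K := by rw [Measure.real, hvol]; rfl
    refine h_int.trans ((ih K' hK' hconv' a' ha' b' hb' c' hc' h' hmax').trans ?_)
    rw [hV]
    apply ENNReal.ofReal_le_ofReal
    have h3 : volume.real K - triArea a' b' c' ≤ 5 / 6 * (volume.real K - triArea a b c) := by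
      linarith
    calc _ ≤ volume.real K ^ 4 / 12 + 3 * volume.real K ^ 3 * (5 / 6) ^ n *
          (5 / 6 * (volume.real K - triArea a b c)) := by gcongr
      _ = _ := by ring

/-- Among planar convex bodies of given area, triangles maximize the mean area of a random
triangle. -/
theorem triInt_le (hK : IsCompact K) (hconv : Convex ℝ K) :
    triInt K ≤ ENNReal.ofReal (volume.real K ^ 4 / 12) := by
  rcases K.eq_empty_or_nonempty with rfl | hne
  · simp [triInt]
  obtain ⟨a, ha, b, hb, c, hc, hmax⟩ := exists_max_triangle hK hne
  by_cases h : cross a b c = 0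
  · have h0 : triArea a b c = 0 := by rw [triArea, h]; simp
    have hm := hK.measurableSet
    have : triInt K ≤ ∫⁻ z in K ×ˢ K ×ˢ K, 0 := by
      rw [triInt_eq_prod]
      refine setLIntegral_mono' (hm.prod (hm.prod hm)) fun z hz => ?_
      rw [ENNReal.ofReal_of_nonpos]
      exact (hmax _ hz.1 _ hz.2.1 _ hz.2.2).trans h0.le
    rw [lintegral_zero] at this
    exact this.trans bot_le
  · have hlim : Filter.Tendsto (fun n : ℕ => ENNReal.ofReal (volume.real K ^ 4 / 12 +
        3 * volume.real K ^ 3 * (5 / 6) ^ n * (volume.real K - triArea a b c))) Filter.atTop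
        (nhds (ENNReal.ofReal (volume.real K ^ 4 / 12))) := by
      apply ENNReal.tendsto_ofReal
      have := tendsto_pow_atTop_nhds_zero_of_lt_one (r := (5 / 6 : ℝ)) (by norm_num) (by norm_num)
      simpa using (((this.const_mul (3 * volume.real K ^ 3)).mul_const
        (volume.real K - triArea a b c)).const_add (volume.real K ^ 4 / 12))
    exact ge_of_tendsto' hlim fun n =>
      triInt_le_add_geometric n K hK hconv a ha b hb c hc h hmax

section Cdf

variable {ν : Measure ℝ} [IsFiniteMeasure ν]

lemma monotone_real_Iic : Monotone fun u => ν.real (Iic u) :=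
  fun _ _ h => measureReal_mono (Iic_subset_Iic.2 h)

lemma exists_real_Iic_eq [NullSingletonClass ν] {l m : ℝ} (hlm : l ≤ m) (hl : ν (Iic l) = 0)
    (hm : ν (Ioi m) = 0) {s : ℝ} (h0 : 0 ≤ s) (h1 : s ≤ ν.real univ) :
    ∃ u, ν.real (Iic u) = s := by
  have hc : Continuous fun u => ∫ _ in l..u, (1 : ℝ) ∂ν :=
    intervalIntegral.continuous_primitive (fun _ _ => intervalIntegrable_const) l
  have e : ∀ u, l ≤ u → ∫ _ in l..u, (1 : ℝ) ∂ν = ν.real (Iic u) := fun u hu => by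
    have e1 : Ioc u l = ∅ := Ioc_eq_empty (not_lt.2 hu)
    have e2 : ν (Ioc l u) = ν (Iic u) := by rw [← Iic_sdiff_Iic, measure_sdiff_null hl]
    rw [intervalIntegral.integral_const', e1, measureReal_def, e2]
    simp [measureReal_def]
  have hT : ν.real (Iic m) = ν.real univ := by
    rw [← compl_Ioi, measureReal_def, measure_compl measurableSet_Ioi (measure_ne_top _ _), hm]
    simp [measureReal_def]
  obtain ⟨u, hu, h⟩ := intermediate_value_Icc hlm hc.continuousOn (show s ∈ Icc _ _ from
    ⟨by simpa using h0, by simp only [e m hlm, hT]; exact h1⟩)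
  exact ⟨u, by rw [← e u hu.1]; exact h⟩

lemma map_real_Iic [NullSingletonClass ν] {l m : ℝ} (hlm : l ≤ m) (hl : ν (Iic l) = 0)
    (hm : ν (Ioi m) = 0) :
    ν.map (fun u => ν.real (Iic u)) = volume.restrict (Icc 0 (ν.real univ)) := by
  have hmeas : Measurable fun u => ν.real (Iic u) := monotone_real_Iic.measurable
  have hfin : IsFiniteMeasure (ν.map fun u => ν.real (Iic u)) :=
    Measure.isFiniteMeasure_map ν _
  refine Measure.ext_of_Iic _ _ fun s => ?_
  rw [Measure.map_apply hmeas measurableSet_Iic, Measure.restrict_apply measurableSet_Iic]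
  rcases lt_or_ge s 0 with h0 | h0
  · have e1 : (fun u => ν.real (Iic u)) ⁻¹' Iic s = ∅ := by
      ext u
      simp only [mem_preimage, mem_Iic, mem_empty_iff_false, iff_false, not_le]
      exact h0.trans_le measureReal_nonneg
    have e2 : Iic s ∩ Icc 0 (ν.real univ) = ∅ := by
      ext u
      simp only [mem_inter_iff, mem_Iic, mem_Icc, mem_empty_iff_false, iff_false]
      rintro ⟨h, h', -⟩; linarith
    rw [e1, e2, measure_empty, measure_empty]
  rcases le_or_gt (ν.real univ) s with h1 | h1
  · have e1 : (fun u => ν.real (Iic u)) ⁻¹' Iic s = univ := by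
      ext u
      simp only [mem_preimage, mem_Iic, mem_univ, iff_true]
      exact (measureReal_mono (subset_univ _)).trans h1
    have e2 : Iic s ∩ Icc 0 (ν.real univ) = Icc 0 (ν.real univ) :=
      inter_eq_right.2 fun u hu => hu.2.trans h1
    rw [e1, e2, Real.volume_Icc, sub_zero, ofReal_measureReal]
  · have e2 : Iic s ∩ Icc 0 (ν.real univ) = Icc 0 s := by
      ext u
      simp only [mem_inter_iff, mem_Iic, mem_Icc]
      exact ⟨fun h => ⟨h.2.1, h.1⟩, fun h => ⟨h.2, h.1, h.2.trans h1.le⟩⟩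
    rw [e2, Real.volume_Icc, sub_zero]
    apply le_antisymm
    · refine le_of_forall_gt_imp_ge_of_dense fun x hx => ?_
      by_cases hxt : x = ∞
      · rw [hxt]; exact le_top
      lift x to NNReal using hxt
      have hsx : s < x := by
        by_contra! h
        have := ENNReal.ofReal_le_ofReal h
        rw [ENNReal.ofReal_coe_nnreal] at this
        exact absurd hx (not_lt.2 this)
      obtain ⟨u, hu⟩ := exists_real_Iic_eq hlm hl hm (s := min x (ν.real univ))
        (le_min x.2 measureReal_nonneg) (min_le_right _ _)
      calc ν ((fun u => ν.real (Iic u)) ⁻¹' Iic s) ≤ ν (Iic u) := by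
            refine measure_mono fun w hw => ?_
            by_contra hwu
            have := monotone_real_Iic (ν := ν) (le_of_lt (not_le.1 hwu))
            have hw' : ν.real (Iic w) ≤ s := hw
            have : min (x : ℝ) (ν.real univ) ≤ s := hu ▸ this.trans hw'
            exact absurd (lt_min hsx h1) (not_lt.2 this)
        _ = ENNReal.ofReal (min x (ν.real univ)) := by rw [← hu, ofReal_measureReal]
        _ ≤ ENNReal.ofReal x := ENNReal.ofReal_le_ofReal (min_le_left _ _)
        _ = x := ENNReal.ofReal_coe_nnreal
    · obtain ⟨u, hu⟩ := exists_real_Iic_eq hlm hl hm h0 h1.le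
      rw [← hu, ofReal_measureReal]
      exact measure_mono fun w hw => monotone_real_Iic (ν := ν) hw

end Cdf

lemma lintegral_arcsine_le (T : ℝ) :
    ∫⁻ s in Icc 0 T, ENNReal.ofReal (1 / √(s * (T - s))) ≤ ENNReal.ofReal Real.pi := by
  rcases le_or_gt T 0 with hT | hT
  · have : volume (Icc 0 T) = 0 := by simp [hT]
    rw [setLIntegral_measure_zero _ _ this]; exact bot_le
  have hcont : ContinuousOn (fun s => Real.arcsin (2 * s / T - 1)) (Icc 0 T) :=
    (Real.continuous_arcsin.comp (by fun_prop)).continuousOn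
  have hder : ∀ s ∈ Ioo 0 T,
      HasDerivAt (fun s => Real.arcsin (2 * s / T - 1)) (1 / √(s * (T - s))) s := by
    rintro s ⟨h0, h1⟩
    have hlt : 2 * s / T < 2 := by rw [div_lt_iff₀ hT]; linarith
    have hgt : 0 < 2 * s / T := by positivity
    have hin : HasDerivAt (fun s => 2 * s / T - 1) (2 / T) s := by
      simpa using (((hasDerivAt_id s).const_mul 2).div_const T).sub_const 1
    have := (Real.hasDerivAt_arcsin (x := 2 * s / T - 1) (by linarith) (by linarith)).comp s hin
    have e : 1 - (2 * s / T - 1) ^ 2 = (2 / T) ^ 2 * (s * (T - s)) := by field_simp; ring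
    have hp : 0 < √(s * (T - s)) := Real.sqrt_pos.2 (mul_pos h0 (by linarith))
    have e' : 1 / √(1 - (2 * s / T - 1) ^ 2) * (2 / T) = 1 / √(s * (T - s)) := by
      rw [e, Real.sqrt_mul (by positivity), Real.sqrt_sq (by positivity)]
      field_simp
    rwa [e'] at this
  have hpos : ∀ s, 0 ≤ 1 / √(s * (T - s)) := fun s => by positivity
  have h_int := intervalIntegral.integrableOn_deriv_of_nonneg hcont hder fun s _ => hpos s
  rw [Measure.restrict_congr_set Ioc_ae_eq_Icc.symm, ← ofReal_integral_eq_lintegral_ofReal h_int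
    (Filter.Eventually.of_forall hpos), ← intervalIntegral.integral_of_le hT.le,
    intervalIntegral.integral_eq_sub_of_hasDerivAt_of_le hT.le hcont hder
      ((intervalIntegrable_iff_integrableOn_Ioc_of_le hT.le).2 h_int)]
  apply ENNReal.ofReal_le_ofReal
  rw [mul_div_assoc, div_self hT.ne']
  norm_num

/-- A weighted layer-cake formula for the mean distance on the line. -/
lemma lintegral_abs_sub_eq (ν : Measure ℝ) [SFinite ν] :
    ∫⁻ u, ∫⁻ w, ENNReal.ofReal |u - w| ∂ν ∂ν = 2 * ∫⁻ s, ν (Iic s) * ν (Ioi s) := by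
  have hA : MeasurableSet {z : (ℝ × ℝ) × ℝ | z.1.1 ≤ z.2 ∧ z.2 < z.1.2} := by
    have m1 : MeasurableSet {z : (ℝ × ℝ) × ℝ | z.1.1 ≤ z.2} :=
      measurableSet_le (by fun_prop) (by fun_prop)
    have m2 : MeasurableSet {z : (ℝ × ℝ) × ℝ | z.2 < z.1.2} :=
      measurableSet_lt (by fun_prop) (by fun_prop)
    exact m1.inter m2
  set F : ℝ → ℝ → ℝ → ℝ≥0∞ := fun u w s =>
    {z : (ℝ × ℝ) × ℝ | z.1.1 ≤ z.2 ∧ z.2 < z.1.2}.indicator 1 ((u, w), s) with hF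
  have hFm : Measurable fun z : (ℝ × ℝ) × ℝ => F z.1.1 z.1.2 z.2 := measurable_one.indicator hA
  have hFs : ∀ u w s, F u w s = (Iic s).indicator 1 u * (Ioi s).indicator 1 w := by
    intro u w s
    by_cases h1 : u ≤ s <;> by_cases h2 : s < w <;> simp [hF, indicator, h1, h2]
  have hone : ∫⁻ u, ∫⁻ w, ∫⁻ s, F u w s ∂volume ∂ν ∂ν = ∫⁻ s, ν (Iic s) * ν (Ioi s) := by
    have h1 : ∀ u, ∫⁻ w, ∫⁻ s, F u w s ∂volume ∂ν = ∫⁻ s, ∫⁻ w, F u w s ∂ν := fun u => by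
      rw [lintegral_lintegral_swap]
      exact (hFm.comp (by fun_prop : Measurable fun z : ℝ × ℝ => ((u, z.1), z.2))).aemeasurable
    simp_rw [h1]
    rw [lintegral_lintegral_swap]
    · refine lintegral_congr fun s => ?_
      simp_rw [hFs]
      have h2 : ∀ u, ∫⁻ w, (Iic s).indicator 1 u * (Ioi s).indicator (1 : ℝ → ℝ≥0∞) w ∂ν =
          (Iic s).indicator 1 u * ν (Ioi s) := fun u => by
        rw [lintegral_const_mul _ (measurable_one.indicator measurableSet_Ioi),
          lintegral_indicator_one measurableSet_Ioi]
      simp_rw [h2]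
      rw [lintegral_mul_const _ (measurable_one.indicator measurableSet_Iic),
        lintegral_indicator_one measurableSet_Iic]
    · have : Measurable fun z : (ℝ × ℝ) × ℝ => F z.1.1 z.2 z.1.2 :=
        hFm.comp (by fun_prop : Measurable fun z : (ℝ × ℝ) × ℝ => ((z.1.1, z.2), z.1.2))
      exact this.lintegral_prod_right'.aemeasurable
  have habs : ∀ u w, ENNReal.ofReal |u - w| = (∫⁻ s, F u w s) + ∫⁻ s, F w u s := by
    have hv : ∀ u w, ∫⁻ s, F u w s = ENNReal.ofReal (w - u) := fun u w => by
      have : ∀ s, F u w s = (Ico u w).indicator 1 s := fun s => by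
        simp [hF, indicator]
      simp_rw [this]
      rw [lintegral_indicator_one measurableSet_Ico, Real.volume_Ico]
    intro u w
    rw [hv, hv]
    rcases le_total u w with h | h
    · rw [abs_of_nonpos (by linarith), ENNReal.ofReal_of_nonpos (p := u - w) (by linarith),
        add_zero, neg_sub]
    · rw [abs_of_nonneg (by linarith), ENNReal.ofReal_of_nonpos (p := w - u) (by linarith),
        zero_add]
  have hm2 : Measurable fun z : ℝ × ℝ => ∫⁻ s, F z.1 z.2 s := hFm.lintegral_prod_right'
  have hm2' : ∀ u, Measurable fun w => ∫⁻ s, F u w s := fun u =>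
    hm2.comp (by fun_prop : Measurable fun w : ℝ => (u, w))
  simp_rw [habs]
  simp_rw [lintegral_add_left (hm2' _)]
  rw [lintegral_add_left hm2.lintegral_prod_right', two_mul, hone]
  congr 1
  rw [lintegral_lintegral_swap, hone]
  exact (hm2.comp measurable_swap).aemeasurable

lemma lintegral_mul_left_scale {t : ℝ} (ht : 0 < t) {f : ℝ → ℝ≥0∞} (hf : Measurable f) :
    ∫⁻ s, f (s / t) = ENNReal.ofReal t * ∫⁻ u, f u := by
  have h := Real.smul_map_volume_mul_left ht.ne'
  conv_lhs => rw [← h]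
  rw [lintegral_smul_measure, lintegral_map (by fun_prop) (by fun_prop), abs_of_pos ht, smul_eq_mul]
  simp_rw [mul_div_cancel_left₀ _ ht.ne']

/-- Change of variables to abscissa and slope in the right half-plane. -/
lemma lintegral_slope {g : ℝ × ℝ → ℝ≥0∞} (hg : Measurable g) :
    ∫⁻ p in {p : ℝ × ℝ | 0 < p.1}, g (p.1, p.2 / p.1) =
      ∫⁻ u, ∫⁻ t in Ioi 0, ENNReal.ofReal t * g (t, u) := by
  have e : {p : ℝ × ℝ | 0 < p.1} = Ioi 0 ×ˢ univ := by ext; simp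
  have hm : Measurable fun p : ℝ × ℝ => g (p.1, p.2 / p.1) := by fun_prop
  have hm' : Measurable fun z : ℝ × ℝ => ENNReal.ofReal z.1 * g (z.1, z.2) := by fun_prop
  have hin : ∀ t ∈ Ioi (0 : ℝ), ∫⁻ s in univ, g (t, s / t) =
      ∫⁻ u, ENNReal.ofReal t * g (t, u) := fun t ht => by
    have hgt : Measurable fun u => g (t, u) := by fun_prop
    rw [Measure.restrict_univ, lintegral_mul_left_scale (f := fun u => g (t, u)) ht hgt,
      lintegral_const_mul _ hgt]
  rw [e, Measure.volume_eq_prod, setLIntegral_prod _ hm.aemeasurable,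
    setLIntegral_congr_fun measurableSet_Ioi hin, lintegral_lintegral_swap hm'.aemeasurable]

lemma lintegral_mul_sub_le {k : ℝ} (hk : 0 < k) :
    ∫⁻ t in Ioi 0, ENNReal.ofReal t * ENNReal.ofReal (1 - k * t) ≤
      ENNReal.ofReal (1 / (6 * k ^ 2)) := by
  have hle : ∀ t ∈ Ioi (0 : ℝ), ENNReal.ofReal t * ENNReal.ofReal (1 - k * t) ≤
      (Icc 0 (1 / k)).indicator (fun t => ENNReal.ofReal (t * (1 - k * t))) t := by
    intro t ht
    by_cases h : t ≤ 1 / k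
    · rw [indicator_of_mem (show t ∈ Icc 0 (1 / k) from ⟨le_of_lt ht, h⟩), ENNReal.ofReal_mul (le_of_lt ht)]
    · rw [ENNReal.ofReal_of_nonpos (p := 1 - k * t), mul_zero]
      · exact bot_le
      · have := (div_lt_iff₀ hk).1 (not_le.1 h)
        linarith
  refine (setLIntegral_mono' measurableSet_Ioi hle).trans ((setLIntegral_le_lintegral _ _).trans ?_)
  rw [lintegral_indicator measurableSet_Icc, lintegral_Icc_of_polynomial (by positivity)
    (.C (1 / 2) * .X ^ 2 - .C (k / 3) * .X ^ 3)]
  · apply ENNReal.ofReal_le_ofReal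
    apply le_of_eq
    simp
    field_simp
    norm_num
  · intro x
    simp
    ring
  · rintro t ⟨h0, h1⟩
    have := (le_div_iff₀ hk).1 h1
    exact mul_nonneg h0 (by linarith)


/-- The mean area of a triangle with one vertex at the origin, the others being random in a set
of given area in the right half-plane, is bounded below. -/
lemma lintegral_triArea_origin_ge (hK : IsCompact K) {ε : ℝ} (hε : 0 < ε)
    (hKε : ∀ p ∈ K, ε ≤ p.1) :
    ENNReal.ofReal (0.09 * volume.real K ^ 3) ≤
      ∫⁻ p in K, ∫⁻ q in K, ENNReal.ofReal (triArea (0, 0) p q) := by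
  have hKm := hK.measurableSet
  have hpos : ∀ p ∈ K, 0 < p.1 := fun p hp => hε.trans_le (hKε p hp)
  set slope : ℝ × ℝ → ℝ := fun p => p.2 / p.1 with hslope
  have hsm : Measurable slope := by fun_prop
  have htm : Measurable fun p : ℝ × ℝ => ENNReal.ofReal p.1 := by fun_prop
  set κ := (volume.restrict K).withDensity fun p => ENNReal.ofReal p.1 with hκ
  have hκfin : IsFiniteMeasure κ := by
    obtain ⟨C, hC⟩ := hK.exists_bound_of_continuousOn (continuous_fst.continuousOn (s := K))
    refine isFiniteMeasure_withDensity (ne_of_lt ?_)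
    have hb : ∀ p ∈ K, ENNReal.ofReal p.1 ≤ ENNReal.ofReal C := fun p hp =>
      ENNReal.ofReal_le_ofReal ((le_abs_self _).trans (hC p hp))
    refine (setLIntegral_mono' hKm hb).trans_lt ?_
    rw [setLIntegral_const]
    exact ENNReal.mul_lt_top ENNReal.ofReal_lt_top hK.measure_lt_top
  set ν := κ.map slope with hν
  have hνfin : IsFiniteMeasure ν := Measure.isFiniteMeasure_map κ slope
  have hνint : ∀ f : ℝ → ℝ≥0∞, Measurable f →
      ∫⁻ u, f u ∂ν = ∫⁻ p in K, ENNReal.ofReal p.1 * f (slope p) := fun f hf => by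
    rw [hν, lintegral_map hf hsm, hκ, lintegral_withDensity_eq_lintegral_mul _ htm
      (g := fun p => f (slope p)) (hf.comp hsm)]
    rfl
  have hνnull : ∀ s, MeasurableSet s → volume (slope ⁻¹' s ∩ K) = 0 → ν s = 0 := by
    intro s hs h
    rw [hν, Measure.map_apply hsm hs]
    refine withDensity_absolutelyContinuous _ _ ?_
    rwa [Measure.restrict_apply (hsm hs)]
  have hatom : NullSingletonClass ν := by
    refine ⟨fun u => hνnull _ (measurableSet_singleton u) (measure_mono_null (t :=
      (fun p : ℝ × ℝ => (p.1, (-u * p.1) + p.2)) ⁻¹' (univ ×ˢ {0})) ?_ ?_)⟩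
    · rintro p ⟨hp, hpK⟩
      refine ⟨mem_univ _, ?_⟩
      have h1 : p.2 / p.1 = u := hp
      rw [div_eq_iff (hpos p hpK).ne'] at h1
      simp [h1]
    · rw [(measurePreserving_shear (f := fun x => -u * x) (by fun_prop)).measure_preimage
        (MeasurableSet.univ.prod (measurableSet_singleton (0 : ℝ))).nullMeasurableSet,
        Measure.volume_eq_prod, Measure.prod_prod]
      simp
  obtain ⟨R, hR⟩ := hK.exists_bound_of_continuousOn (f := slope)
    (continuous_snd.continuousOn.div continuous_fst.continuousOn fun p hp => (hpos p hp).ne')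
  have hR' : ∀ p ∈ K, -R ≤ slope p ∧ slope p ≤ R := fun p hp => abs_le.1 (hR p hp)
  have hl : ν (Iic (-|R| - 1)) = 0 := by
    refine hνnull _ measurableSet_Iic ?_
    convert measure_empty (μ := (volume : Measure (ℝ × ℝ)))
    ext p
    simp only [mem_inter_iff, mem_preimage, mem_Iic, mem_empty_iff_false, iff_false, not_and]
    intro h hp
    linarith [(hR' p hp).1, le_abs_self R]
  have hm : ν (Ioi |R|) = 0 := by
    refine hνnull _ measurableSet_Ioi ?_
    convert measure_empty (μ := (volume : Measure (ℝ × ℝ)))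
    ext p
    simp only [mem_inter_iff, mem_preimage, mem_Ioi, mem_empty_iff_false, iff_false, not_and]
    intro h hp
    linarith [(hR' p hp).2, le_abs_self R]
  set M : ℝ → ℝ := fun u => ν.real (Iic u) with hM
  set T := ν.real univ with hT
  have hMm : Measurable M := monotone_real_Iic.measurable
  have hmap : ν.map M = volume.restrict (Icc 0 T) :=
    map_real_Iic (by linarith [abs_nonneg R]) hl hm
  have hM0 : ∀ u, 0 ≤ M u := fun u => measureReal_nonneg
  have hMT : ∀ u, M u ≤ T := fun u => measureReal_mono (subset_univ _)
  set Q := ∫⁻ s, ENNReal.ofReal (M s * (T - M s)) with hQ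
  have hG : ∫⁻ p in K, ∫⁻ q in K, ENNReal.ofReal (triArea (0, 0) p q) = Q := by
    have e1 : ∀ p ∈ K, ∫⁻ q in K, ENNReal.ofReal (triArea (0, 0) p q) =
        ENNReal.ofReal p.1 * (2⁻¹ * ∫⁻ w, ENNReal.ofReal |slope p - w| ∂ν) := by
      intro p hp
      rw [hνint _ (by fun_prop), ← lintegral_const_mul _ (by fun_prop),
        ← lintegral_const_mul _ (by fun_prop)]
      refine setLIntegral_congr_fun hKm fun q hq => ?_
      have hp0 := hpos p hp
      have hq0 := hpos q hq
      rw [show (2⁻¹ : ℝ≥0∞) = ENNReal.ofReal 2⁻¹ by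
        rw [ENNReal.ofReal_inv_of_pos two_pos]; simp, ← ENNReal.ofReal_mul hq0.le,
        ← ENNReal.ofReal_mul (by positivity), ← ENNReal.ofReal_mul hp0.le]
      congr 1
      have : cross (0, 0) p q = -(p.1 * q.1 * (slope p - slope q)) := by
        simp only [cross, hslope]; field_simp; ring
      rw [triArea, this, abs_neg, abs_mul, abs_of_pos (mul_pos hp0 hq0)]
      ring
    have hmm : Measurable fun u => ∫⁻ w, ENNReal.ofReal |u - w| ∂ν := by
      have : Measurable fun z : ℝ × ℝ => ENNReal.ofReal |z.1 - z.2| := by fun_prop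
      exact this.lintegral_prod_right'
    rw [setLIntegral_congr_fun hKm e1, ← hνint (fun u => 2⁻¹ * ∫⁻ w, ENNReal.ofReal |u - w| ∂ν)
      (hmm.const_mul _), lintegral_const_mul _ hmm, lintegral_abs_sub_eq, ← mul_assoc,
      ENNReal.inv_mul_cancel (by norm_num) (by norm_num), one_mul, hQ]
    refine lintegral_congr fun s => ?_
    rw [ENNReal.ofReal_mul (hM0 s), hM, ofReal_measureReal, ← compl_Iic,
      measure_compl measurableSet_Iic (measure_ne_top _ _),
      ENNReal.ofReal_sub _ measureReal_nonneg, hT, ofReal_measureReal, ofReal_measureReal]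
  rw [hG]
  set E : Set ℝ := {u | 0 < M u ∧ M u < T} with hE
  have hEm : MeasurableSet E := (measurableSet_Ioo (a := (0 : ℝ)) (b := T)).preimage hMm
  have hEnull : ν Eᶜ = 0 := by
    have hsub : Eᶜ ⊆ M ⁻¹' {0, T} := by
      intro u hu
      rcases (hM0 u).eq_or_lt with h | h
      · exact Or.inl h.symm
      · rcases (hMT u).eq_or_lt with h' | h'
        · exact Or.inr h'
        · exact (hu ⟨h, h'⟩).elim
    refine measure_mono_null hsub ?_
    have hfin : ({0, T} : Set ℝ).Finite := toFinite _
    rw [← Measure.map_apply hMm hfin.measurableSet, hmap]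
    exact hfin.measure_zero _
  have hKE : volume (K \ slope ⁻¹' E) = 0 := by
    have hs : MeasurableSet (slope ⁻¹' Eᶜ) := hsm hEm.compl
    have h1 : κ (slope ⁻¹' Eᶜ) = 0 := by rw [← Measure.map_apply hsm hEm.compl]; exact hEnull
    rw [hκ, withDensity_apply _ hs, Measure.restrict_restrict hs, inter_comm] at h1
    have hb : ∀ p ∈ K ∩ slope ⁻¹' Eᶜ, ENNReal.ofReal ε ≤ ENNReal.ofReal p.1 := fun p hp =>
      ENNReal.ofReal_le_ofReal (hKε p hp.1)
    have h2 := setLIntegral_mono' (hKm.inter hs) hb (μ := volume)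
    rw [h1, setLIntegral_const, nonpos_iff_eq_zero, mul_eq_zero] at h2
    exact h2.resolve_left (by simpa using hε)
  have hbound : ∀ A : ℝ, 0 < A → volume K ≤
      ENNReal.ofReal (A * Real.pi) + ENNReal.ofReal (1 / (6 * A ^ 2)) * Q := by
    intro A hA
    set ψ : ℝ → ℝ := fun s => 1 / √(s * (T - s)) with hψ
    have hψ0 : ∀ s, 0 ≤ ψ s := fun s => by positivity
    have hψm : Measurable ψ := by fun_prop
    set g : ℝ × ℝ → ℝ≥0∞ := fun z =>
      (Prod.snd ⁻¹' E).indicator (fun z => ENNReal.ofReal (1 - A * ψ (M z.2) * z.1)) z with hg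
    have hgm : Measurable g := Measurable.indicator (by fun_prop) (measurable_snd hEm)
    have hfirst : ∫⁻ p in K, ENNReal.ofReal p.1 * ENNReal.ofReal (ψ (M (slope p))) ≤
        ENNReal.ofReal Real.pi := by
      rw [← hνint (fun u => ENNReal.ofReal (ψ (M u))) (by fun_prop),
        ← lintegral_map (f := fun s => ENNReal.ofReal (ψ s)) (by fun_prop) hMm, hmap]
      exact lintegral_arcsine_le T
    have hsecond : ∫⁻ p in K, g (p.1, slope p) ≤ ENNReal.ofReal (1 / (6 * A ^ 2)) * Q := by
      calc ∫⁻ p in K, g (p.1, slope p) ≤ ∫⁻ p in {p : ℝ × ℝ | 0 < p.1}, g (p.1, p.2 / p.1) :=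
            lintegral_mono_set hpos
        _ = ∫⁻ u, ∫⁻ t in Ioi 0, ENNReal.ofReal t * g (t, u) := lintegral_slope hgm
        _ ≤ ∫⁻ u, ENNReal.ofReal (1 / (6 * A ^ 2)) * ENNReal.ofReal (M u * (T - M u)) := by
          refine lintegral_mono fun u => ?_
          by_cases hu : u ∈ E
          · have hsq : 0 < M u * (T - M u) := mul_pos hu.1 (by linarith [hu.2])
            have hr : 0 < √(M u * (T - M u)) := Real.sqrt_pos.2 hsq
            have hk : 0 < A * ψ (M u) := by simp only [hψ]; positivity
            have e : ∀ t, g (t, u) = ENNReal.ofReal (1 - A * ψ (M u) * t) := fun t =>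
              indicator_of_mem (show (t, u) ∈ Prod.snd ⁻¹' E from hu) _
            simp_rw [e]
            refine (lintegral_mul_sub_le hk).trans (le_of_eq ?_)
            rw [← ENNReal.ofReal_mul (by positivity)]
            congr 1
            rw [mul_pow, hψ, div_pow, Real.sq_sqrt hsq.le]
            field_simp
          · have e : ∀ t, g (t, u) = 0 := fun t =>
              indicator_of_notMem (show (t, u) ∉ Prod.snd ⁻¹' E from hu) _
            simp [e]
        _ = _ := lintegral_const_mul _ (by fun_prop)
    have hsplit : ∀ p ∈ K ∩ slope ⁻¹' E, 1 ≤ ENNReal.ofReal A *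
        (ENNReal.ofReal p.1 * ENNReal.ofReal (ψ (M (slope p)))) + g (p.1, slope p) := by
      rintro p ⟨hp, hpE⟩
      have e : g (p.1, slope p) = ENNReal.ofReal (1 - A * ψ (M (slope p)) * p.1) :=
        indicator_of_mem (show (p.1, slope p) ∈ Prod.snd ⁻¹' E from hpE) _
      rw [e, ← ENNReal.ofReal_mul (hpos p hp).le, ← ENNReal.ofReal_mul hA.le,
        show A * (p.1 * ψ (M (slope p))) = A * ψ (M (slope p)) * p.1 by ring]
      refine le_trans (le_of_eq ?_) ENNReal.ofReal_add_le
      simp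
    calc volume K ≤ volume (K ∩ slope ⁻¹' E) + volume (K \ slope ⁻¹' E) :=
          measure_le_inter_add_sdiff _ _ _
      _ = ∫⁻ p in K ∩ slope ⁻¹' E, 1 := by rw [hKE, add_zero, setLIntegral_one]
      _ ≤ ∫⁻ p in K ∩ slope ⁻¹' E, (ENNReal.ofReal A *
          (ENNReal.ofReal p.1 * ENNReal.ofReal (ψ (M (slope p)))) + g (p.1, slope p)) :=
          setLIntegral_mono' (hKm.inter (hsm hEm)) hsplit
      _ ≤ ∫⁻ p in K, (ENNReal.ofReal A *
          (ENNReal.ofReal p.1 * ENNReal.ofReal (ψ (M (slope p)))) + g (p.1, slope p)) :=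
          lintegral_mono_set inter_subset_left
      _ = ENNReal.ofReal A * (∫⁻ p in K, ENNReal.ofReal p.1 * ENNReal.ofReal (ψ (M (slope p)))) +
          ∫⁻ p in K, g (p.1, slope p) := by
          rw [lintegral_add_left (by fun_prop), lintegral_const_mul _ (by fun_prop)]
      _ ≤ _ := by
          rw [ENNReal.ofReal_mul hA.le]
          gcongr
  set V := volume.real K with hV
  have hV0 : 0 ≤ V := measureReal_nonneg
  rcases hV0.eq_or_lt with h0 | h0
  · rw [← h0]; simp
  by_contra! hlt
  have hb := hbound (2 * V / (3 * Real.pi)) (by positivity)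
  have hb2 : volume K ≤ ENNReal.ofReal (2 * V / (3 * Real.pi) * Real.pi +
      1 / (6 * (2 * V / (3 * Real.pi)) ^ 2) * (0.09 * V ^ 3)) := by
    refine hb.trans ?_
    rw [ENNReal.ofReal_add (by positivity) (by positivity), ENNReal.ofReal_mul (q := 0.09 * V ^ 3)
      (by positivity)]
    gcongr
  have hb3 : V ≤ _ := ENNReal.toReal_le_of_le_ofReal (by positivity) hb2
  have e : 2 * V / (3 * Real.pi) * Real.pi + 1 / (6 * (2 * V / (3 * Real.pi)) ^ 2) * (0.09 * V ^ 3)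
      = V * (2 / 3 + 0.03375 * Real.pi ^ 2) := by
    have := Real.pi_pos
    field_simp
    ring
  rw [e] at hb3
  have hpi : Real.pi ^ 2 < 3.1416 ^ 2 :=
    pow_lt_pow_left₀ Real.pi_lt_d4 Real.pi_pos.le (by norm_num)
  nlinarith

/-- The mean area of a random triangle with one vertex fixed outside a convex body. -/
theorem lintegral_triArea_ge (hK : IsCompact K) (hconv : Convex ℝ K) {x : ℝ × ℝ} (hx : x ∉ K) :
    ENNReal.ofReal (0.09 * volume.real K ^ 3) ≤
      ∫⁻ p in K, ∫⁻ q in K, ENNReal.ofReal (triArea x p q) := by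
  rcases K.eq_empty_or_nonempty with rfl | ⟨y, hy⟩
  · simp
  obtain ⟨f, u, hfx, hf⟩ := geometric_hahn_banach_point_closed hconv hK.isClosed hx
  set α := f (1, 0) with hα
  set β := f (0, 1) with hβ
  have hf' : ∀ p, f p = p.1 * α + p.2 * β := fun p => by
    have : p = p.1 • (1, 0) + p.2 • (0, 1) := by ext <;> simp
    conv_lhs => rw [this, map_add, map_smul, map_smul]
    rfl
  have hpos : 0 < α ^ 2 + β ^ 2 := by
    by_contra h
    have h1 : α = 0 := by nlinarith [sq_nonneg α, sq_nonneg β]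
    have h2 : β = 0 := by nlinarith [sq_nonneg α, sq_nonneg β]
    have := hf y hy
    rw [hf', h1, h2] at this hfx
    linarith
  set b : ℝ × ℝ := (x.1 + α / (α ^ 2 + β ^ 2), x.2 + β / (α ^ 2 + β ^ 2)) with hb
  set c : ℝ × ℝ := (x.1 - β, x.2 + α) with hc
  have hcr : cross x b c = 1 := by
    simp only [cross, hb, hc]; field_simp; ring
  have hcr0 : cross x b c ≠ 0 := by rw [hcr]; exact one_ne_zero
  set K₀ := triMap x b c ⁻¹' K with hK₀
  have hc₀ : IsCompact K₀ := isCompact_triMap_preimage hcr0 hK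
  have him : triMap x b c '' K₀ = K := image_preimage_triMap hcr0 K
  have hfst : ∀ p ∈ K₀, u - f x ≤ p.1 := fun p hp => by
    have h1 := hf _ hp
    have h2 : f (triMap x b c p) = f x + p.1 := by
      rw [hf', hf', triMap_fst, triMap_snd]
      simp only [hb, hc]; field_simp; ring
    linarith
  have hvol : volume.real K = volume.real K₀ := by
    rw [← him, Measure.real, volume_triMap_image, hcr]; simp [Measure.real]
  have h0 : triMap x b c (0, 0) = x := by ext <;> simp [triMap_fst, triMap_snd]
  have key := lintegral_triArea_origin_ge hc₀ (sub_pos.2 hfx) hfst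
  rw [← hvol] at key
  refine key.trans (le_of_eq ?_)
  conv_rhs => rw [← him]
  simp_rw [lintegral_triMap_image hcr0 hc₀.measurableSet, hcr, abs_one, ENNReal.ofReal_one, one_mul]
  nth_rewrite 1 [← h0]
  simp_rw [triArea, cross_triMap, hcr, one_mul]

/-- Adding to a compact convex set a small region outside it increases the mean area
of a random triangle. -/
lemma triInt_add_le {K' : Set (ℝ × ℝ)} (hK : IsCompact K) (hconv : Convex ℝ K)
    (hK' : IsCompact K') (hsub : K ⊆ K') :
    triInt K + ENNReal.ofReal (3 * (0.09 * volume.real K ^ 3 *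
      (volume.real K' - volume.real K))) ≤ triInt K' := by
  set D := K' \ K with hD
  set c := ENNReal.ofReal (0.09 * volume.real K ^ 3) with hc
  have hDm : MeasurableSet D := hK'.measurableSet.diff hK.measurableSet
  have hKm := hK.measurableSet
  have hdisj : Disjoint K D := disjoint_sdiff_right
  have hun : K' = K ∪ D := (union_sdiff_cancel hsub).symm
  have hDv : volume D = ENNReal.ofReal (volume.real K' - volume.real K) := by
    rw [hD, measure_sdiff hsub hKm.nullMeasurableSet hK.measure_lt_top.ne,
      ENNReal.ofReal_sub _ measureReal_nonneg, ofReal_measureReal hK.measure_lt_top.ne,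
      ofReal_measureReal hK'.measure_lt_top.ne]
  have hrhs : ENNReal.ofReal (3 * (0.09 * volume.real K ^ 3 * (volume.real K' - volume.real K))) =
      c * volume D + c * volume D + c * volume D := by
    rw [hDv, hc, ← ENNReal.ofReal_mul (by positivity), ENNReal.ofReal_mul (by norm_num)]
    simp only [ENNReal.ofReal_ofNat]
    ring
  have hsplit : ∀ g : ℝ × ℝ → ℝ≥0∞, ∫⁻ p in K', g p = (∫⁻ p in K, g p) + ∫⁻ p in D, g p :=
    fun g => by rw [hun, lintegral_union hDm hdisj]
  set F : ℝ × ℝ → ℝ × ℝ → ℝ × ℝ → ℝ≥0∞ := fun p q r => ENNReal.ofReal (triArea p q r) with hF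
  have hout : c * volume D ≤ ∫⁻ x in D, ∫⁻ p in K, ∫⁻ q in K, F x p q := by
    rw [← setLIntegral_const]
    exact setLIntegral_mono' hDm fun x hx => lintegral_triArea_ge hK hconv hx.2
  have hin : ∀ p, Measurable fun z : (ℝ × ℝ) × (ℝ × ℝ) => F p z.1 z.2 := fun p => by
    simp only [hF]; fun_prop
  have e2 : ∫⁻ p in K, ∫⁻ x in D, ∫⁻ q in K, F p x q =
      ∫⁻ x in D, ∫⁻ p in K, ∫⁻ q in K, F x p q := by
    have hm : Measurable fun z : (ℝ × ℝ) × (ℝ × ℝ) => ∫⁻ q in K, F z.1 z.2 q := by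
      refine Measurable.lintegral_prod_right' (f := fun w : ((ℝ × ℝ) × (ℝ × ℝ)) × (ℝ × ℝ) =>
        F w.1.1 w.1.2 w.2) ?_
      simp only [hF]; fun_prop
    rw [lintegral_lintegral_swap hm.aemeasurable]
    refine lintegral_congr fun x => lintegral_congr fun p => lintegral_congr fun q => ?_
    simp only [hF]
    rw [triArea_swap]
  have e3 : ∫⁻ p in K, ∫⁻ q in K, ∫⁻ x in D, F p q x =
      ∫⁻ p in K, ∫⁻ x in D, ∫⁻ q in K, F p x q := by
    refine lintegral_congr fun p => ?_
    rw [lintegral_lintegral_swap (hin p).aemeasurable]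
    refine lintegral_congr fun x => lintegral_congr fun q => ?_
    simp only [hF]
    rw [triArea_rotate, triArea_swap, ← triArea_rotate, triArea_swap]
  have hm1 : ∀ (p : ℝ × ℝ) (A : Set (ℝ × ℝ)), Measurable fun q => ∫⁻ r in A, F p q r :=
    fun p A => (hin p).lintegral_prod_right'
  have hm2 : ∀ A B : Set (ℝ × ℝ), Measurable fun p => ∫⁻ q in A, ∫⁻ r in B, F p q r :=
    fun A B => by
      refine Measurable.lintegral_prod_right' (f := fun w : (ℝ × ℝ) × (ℝ × ℝ) =>
        ∫⁻ r in B, F w.1 w.2 r) ?_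
      refine Measurable.lintegral_prod_right' (f := fun w : ((ℝ × ℝ) × (ℝ × ℝ)) × (ℝ × ℝ) =>
        F w.1.1 w.1.2 w.2) ?_
      simp only [hF]; fun_prop
  have hinner : ∀ p, (∫⁻ q in K, ∫⁻ r in K, F p q r) + ((∫⁻ q in K, ∫⁻ x in D, F p q x) +
      ∫⁻ x in D, ∫⁻ r in K, F p x r) ≤ ∫⁻ q in K', ∫⁻ r in K', F p q r := fun p => by
    rw [hsplit, ← add_assoc]
    refine add_le_add (le_of_eq ?_) (lintegral_mono fun x => lintegral_mono_set hsub)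
    simp_rw [hsplit]
    rw [lintegral_add_left (hm1 p K)]
  calc _ ≤ triInt K + ((∫⁻ p in K, ∫⁻ q in K, ∫⁻ x in D, F p q x) +
        ∫⁻ p in K, ∫⁻ x in D, ∫⁻ q in K, F p x q) + ∫⁻ x in D, ∫⁻ p in K, ∫⁻ q in K, F x p q := by
        rw [e3, e2, hrhs, add_assoc (triInt K)]; gcongr
    _ = (∫⁻ p in K, ((∫⁻ q in K, ∫⁻ r in K, F p q r) + ((∫⁻ q in K, ∫⁻ x in D, F p q x) +
          ∫⁻ x in D, ∫⁻ r in K, F p x r))) + ∫⁻ x in D, ∫⁻ p in K, ∫⁻ q in K, F x p q := by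
        rw [lintegral_add_left (hm2 K K), lintegral_add_left (hm2 K D)]; rfl
    _ ≤ ∫⁻ p in K', ∫⁻ q in K', ∫⁻ r in K', F p q r := by
        rw [hsplit]
        refine add_le_add (lintegral_mono hinner) (lintegral_mono fun x => ?_)
        exact (lintegral_mono_set hsub).trans (lintegral_mono fun p => lintegral_mono_set hsub)

lemma triInt_div_le_of_small {K' : Set (ℝ × ℝ)} (hK : IsCompact K) (hconv : Convex ℝ K)
    (hK' : IsCompact K') (hsub : K ⊆ K') (hpos : 0 < volume.real K)
    (hsmall : volume.real K' ≤ 1.061 * volume.real K) :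
    triInt K / ENNReal.ofReal (volume.real K ^ 3) ≤
      triInt K' / ENNReal.ofReal (volume.real K' ^ 3) := by
  have h1 := triInt_add_le hK hconv hK' hsub
  have h2 := triInt_le hK hconv
  have hle : volume.real K ≤ volume.real K' := measureReal_mono hsub hK'.measure_lt_top.ne
  have hT : triInt K ≠ ∞ := ne_top_of_le_ne_top ENNReal.ofReal_ne_top h2
  obtain ⟨t, ht, htK⟩ : ∃ t : ℝ, 0 ≤ t ∧ triInt K = ENNReal.ofReal t :=
    ⟨_, ENNReal.toReal_nonneg, (ENNReal.ofReal_toReal hT).symm⟩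
  rw [htK] at h1 h2 ⊢
  set V := volume.real K
  set W := volume.real K'
  have hW : 0 < W := hpos.trans_le hle
  have ht' : t ≤ V ^ 4 / 12 := (ENNReal.ofReal_le_ofReal_iff (by positivity)).1 h2
  have hd : 0 ≤ 3 * (0.09 * V ^ 3 * (W - V)) :=
    mul_nonneg (by norm_num) (mul_nonneg (by positivity) (by linarith))
  rw [← ENNReal.ofReal_add ht hd] at h1
  refine le_trans ?_ (ENNReal.div_le_div_right h1 _)
  rw [← ENNReal.ofReal_div_of_pos (by positivity), ← ENNReal.ofReal_div_of_pos (by positivity)]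
  apply ENNReal.ofReal_le_ofReal
  rw [div_le_div_iff₀ (by positivity) (by positivity)]
  have h3 : t * (W ^ 3 - V ^ 3) ≤ V ^ 4 / 12 * (W ^ 3 - V ^ 3) :=
    mul_le_mul_of_nonneg_right ht' (sub_nonneg.2 (pow_le_pow_left₀ hpos.le hle 3))
  have h4 : V * (W ^ 2 + W * V + V ^ 2) ≤ 3.24 * V ^ 3 := by
    have : W ^ 2 + W * V + V ^ 2 ≤ 3.24 * V ^ 2 := by nlinarith
    nlinarith
  have h5 : V ^ 3 * (W - V) * (V * (W ^ 2 + W * V + V ^ 2)) ≤ V ^ 3 * (W - V) * (3.24 * V ^ 3) :=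
    mul_le_mul_of_nonneg_left h4 (mul_nonneg (by positivity) (by linarith))
  nlinarith

lemma volume_real_image_homothety (z : ℝ × ℝ) (r : ℝ) (s : Set (ℝ × ℝ)) :
    volume.real (AffineMap.homothety z r '' s) = r ^ 2 * volume.real s := by
  rw [Measure.real, Measure.addHaar_image_homothety, ENNReal.toReal_mul, Module.finrank_prod,
    Module.finrank_self, abs_of_nonneg (sq_nonneg r), ENNReal.toReal_ofReal (sq_nonneg r)]
  rfl

lemma inv_smul_mem_of_mem_image_homothety {z x : ℝ × ℝ} {r : ℝ} (hr : r ≠ 0) {s : Set (ℝ × ℝ)} :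
    x ∈ AffineMap.homothety z r '' s ↔ z + r⁻¹ • (x - z) ∈ s := by
  constructor
  · rintro ⟨y, hy, rfl⟩
    simpa [AffineMap.homothety_apply, smul_smul, hr] using hy
  · intro h
    refine ⟨_, h, ?_⟩
    simp [AffineMap.homothety_apply, smul_smul, hr]

/-- Planar convex bodies inside one another: the normalized integral of the triangle area
is monotone. -/
theorem triInt_div_le {K L : Set (ℝ × ℝ)} (hK : IsCompact K) (hKc : Convex ℝ K)
    (hKi : (interior K).Nonempty) (hL : IsCompact L) (hLc : Convex ℝ L) (hKL : K ⊆ L) :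
    triInt K / ENNReal.ofReal (volume.real K ^ 3) ≤
      triInt L / ENNReal.ofReal (volume.real L ^ 3) := by
  obtain ⟨z, hz⟩ := hKi
  have hzK : z ∈ K := interior_subset hz
  have hVK : 0 < volume.real K :=
    ENNReal.toReal_pos (Measure.measure_pos_of_nonempty_interior _ ⟨z, hz⟩).ne' hK.measure_lt_top.ne
  set M : ℕ → Set (ℝ × ℝ) := fun n => L ∩ AffineMap.homothety z ((1.03 : ℝ) ^ n) '' K with hM
  have hMcomp : ∀ n, IsCompact (M n) := fun n =>
    hL.inter_right (hK.image (AffineMap.homothety_continuous z _)).isClosed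
  have hMconv : ∀ n, Convex ℝ (M n) := fun n => hLc.inter (hKc.affine_image _)
  have hM0 : M 0 = K := by
    have : (AffineMap.homothety z ((1.03 : ℝ) ^ 0) : (ℝ × ℝ) →ᵃ[ℝ] (ℝ × ℝ)) = AffineMap.id ℝ _ := by
      rw [pow_zero, AffineMap.homothety_one]
    simp only [hM, this]
    simpa using hKL
  have hMmono : ∀ n, M n ⊆ M (n + 1) := fun n => by
    refine inter_subset_inter_right _ ?_
    rw [pow_succ, AffineMap.homothety_mul, AffineMap.coe_comp, image_comp]
    refine image_mono ?_
    exact (hKc.subset_interior_image_homothety_of_one_lt hz _ (by norm_num)).trans interior_subset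
  have hMK : ∀ n, K ⊆ M n := fun n => by
    induction n with
    | zero => exact hM0.ge
    | succ n ih => exact ih.trans (hMmono n)
  have hMpos : ∀ n, 0 < volume.real (M n) := fun n =>
    hVK.trans_le (measureReal_mono (hMK n) (hMcomp n).measure_lt_top.ne)
  have hMvol : ∀ n, volume.real (M (n + 1)) ≤ 1.061 * volume.real (M n) := fun n => by
    have hsub : M (n + 1) ⊆ AffineMap.homothety z (1.03 : ℝ) '' M n := by
      rintro x ⟨hxL, hx⟩
      rw [inv_smul_mem_of_mem_image_homothety (by norm_num)]
      refine ⟨?_, ?_⟩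
      · exact hLc.add_smul_sub_mem (hKL hzK) hxL (t := (1.03 : ℝ)⁻¹) ⟨by norm_num, by norm_num⟩
      · rw [inv_smul_mem_of_mem_image_homothety (by positivity)] at hx ⊢
        rwa [add_sub_cancel_left, smul_smul, ← mul_inv, ← pow_succ]
    refine (measureReal_mono hsub ((hMcomp n).image
      (AffineMap.homothety_continuous z _)).measure_lt_top.ne).trans ?_
    rw [volume_real_image_homothety]
    have := hMpos n
    gcongr
    norm_num
  have hstep : ∀ n, triInt K / ENNReal.ofReal (volume.real K ^ 3) ≤
      triInt (M n) / ENNReal.ofReal (volume.real (M n) ^ 3) := fun n => by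
    induction n with
    | zero => rw [hM0]
    | succ n ih =>
      exact ih.trans (triInt_div_le_of_small (hMcomp n) (hMconv n) (hMcomp (n + 1)) (hMmono n)
        (hMpos n) (hMvol n))
  obtain ⟨ε, hε, hball⟩ := Metric.isOpen_iff.1 isOpen_interior z hz
  obtain ⟨R, hR⟩ := hL.isBounded.subset_ball z
  obtain ⟨n, hn⟩ := pow_unbounded_of_one_lt (R / ε) (by norm_num : (1 : ℝ) < 1.03)
  have hML : M n = L := by
    refine inter_eq_left.2 fun x hx => ?_
    rw [inv_smul_mem_of_mem_image_homothety (by positivity)]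
    refine interior_subset (hball ?_)
    have h1 : ‖x - z‖ < R := by simpa [dist_eq_norm] using hR hx
    rw [Metric.mem_ball, dist_eq_norm, add_sub_cancel_left, norm_smul, norm_inv,
      Real.norm_of_nonneg (by positivity), inv_mul_lt_iff₀ (by positivity)]
    exact h1.trans ((div_lt_iff₀ hε).1 hn)
  rw [← hML]
  exact hstep n

/-- Coordinates on the Euclidean plane. -/
noncomputable def planeEquiv : EuclideanSpace ℝ (Fin 2) ≃L[ℝ] ℝ × ℝ :=
  (EuclideanSpace.equiv (Fin 2) ℝ).trans (ContinuousLinearEquiv.finTwoArrow ℝ ℝ)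

/-- The coordinate on the Euclidean line. -/
noncomputable def lineEquiv : EuclideanSpace ℝ (Fin 1) ≃L[ℝ] ℝ :=
  (EuclideanSpace.equiv (Fin 1) ℝ).trans (ContinuousLinearEquiv.funUnique (Fin 1) ℝ ℝ)

lemma measurePreserving_planeEquiv : MeasurePreserving planeEquiv :=
  (volume_preserving_finTwoArrow ℝ).comp
    (EuclideanSpace.volume_preserving_symm_measurableEquiv_toLp (Fin 2))

lemma measurePreserving_lineEquiv : MeasurePreserving lineEquiv :=
  (volume_preserving_funUnique (Fin 1) ℝ).comp
    (EuclideanSpace.volume_preserving_symm_measurableEquiv_toLp (Fin 1))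

section Transfer

variable {d : ℕ} {F : Type*} [NormedAddCommGroup F] [NormedSpace ℝ F] [MeasureSpace F]
  [BorelSpace F] (e : EuclideanSpace ℝ (Fin d) ≃L[ℝ] F)

lemma measurableEmbedding_equiv : MeasurableEmbedding e :=
  e.toHomeomorph.measurableEmbedding

variable {e}

lemma volume_convexHull_equiv (he : MeasurePreserving e) (s : Set (EuclideanSpace ℝ (Fin d))) :
    volume (convexHull ℝ s) = volume (convexHull ℝ (e '' s)) := by
  have hl : IsLinearMap ℝ e := e.toLinearEquiv.toLinearMap.isLinear
  rw [← hl.image_convexHull,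
    ← he.measure_preimage_emb (measurableEmbedding_equiv e)]
  congr 1
  exact (preimage_image_eq _ e.injective).symm

lemma volume_image_equiv (he : MeasurePreserving e) (s : Set (EuclideanSpace ℝ (Fin d))) :
    volume (e '' s) = volume s := by
  rw [← he.measure_preimage_emb (measurableEmbedding_equiv e), preimage_image_eq _ e.injective]

end Transfer

/-- Three points of the Euclidean plane as three pairs of coordinates. -/
noncomputable def tripleEquiv :
    (Fin 3 → EuclideanSpace ℝ (Fin 2)) ≃ᵐ (ℝ × ℝ) × (ℝ × ℝ) × (ℝ × ℝ) :=
  let e := planeEquiv.toHomeomorph.toMeasurableEquiv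
  (MeasurableEquiv.piFinSuccAbove (fun _ : Fin 3 => EuclideanSpace ℝ (Fin 2)) 0).trans
    (e.prodCongr (MeasurableEquiv.finTwoArrow.trans (e.prodCongr e)))

/-- Two points of the Euclidean line as a pair of real numbers. -/
noncomputable def pairEquiv : (Fin 2 → EuclideanSpace ℝ (Fin 1)) ≃ᵐ ℝ × ℝ :=
  let e := lineEquiv.toHomeomorph.toMeasurableEquiv
  MeasurableEquiv.finTwoArrow.trans (e.prodCongr e)

lemma tripleEquiv_apply (X : Fin 3 → EuclideanSpace ℝ (Fin 2)) :
    tripleEquiv X = (planeEquiv (X 0), planeEquiv (X 1), planeEquiv (X 2)) := rfl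

lemma pairEquiv_apply (X : Fin 2 → EuclideanSpace ℝ (Fin 1)) :
    pairEquiv X = (lineEquiv (X 0), lineEquiv (X 1)) := rfl

lemma measurePreserving_pairEquiv : MeasurePreserving pairEquiv :=
  (measurePreserving_lineEquiv.prod measurePreserving_lineEquiv).comp
    (volume_preserving_finTwoArrow _)

lemma measurePreserving_tripleEquiv : MeasurePreserving tripleEquiv :=
  (measurePreserving_planeEquiv.prod
    ((measurePreserving_planeEquiv.prod measurePreserving_planeEquiv).comp
      (volume_preserving_finTwoArrow _))).comp
    (volume_preserving_piFinSuccAbove (fun _ : Fin 3 => EuclideanSpace ℝ (Fin 2)) 0)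

lemma expVolSimplex_two (K : Set (EuclideanSpace ℝ (Fin 2))) :
    expVolSimplex 2 K = (triInt (planeEquiv '' K) /
      ENNReal.ofReal (volume.real (planeEquiv '' K) ^ 3)).toReal := by
  have hpre : univ.pi (fun _ : Fin 3 => K) = tripleEquiv ⁻¹'
      ((planeEquiv '' K) ×ˢ (planeEquiv '' K) ×ˢ (planeEquiv '' K)) := by
    ext X
    simp [tripleEquiv_apply, Fin.forall_fin_succ]
  have hvol : ∀ X : Fin 3 → EuclideanSpace ℝ (Fin 2), (volume (convexHull ℝ (range X))).toReal =
      triArea (tripleEquiv X).1 (tripleEquiv X).2.1 (tripleEquiv X).2.2 := fun X => by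
    have hr : planeEquiv '' range X = {planeEquiv (X 0), planeEquiv (X 1), planeEquiv (X 2)} := by
      rw [← range_comp]
      ext p
      simp [Fin.exists_fin_succ, eq_comm]
    rw [volume_convexHull_equiv measurePreserving_planeEquiv, hr, volume_convexHull_triple,
      ENNReal.toReal_ofReal (triArea_nonneg _ _ _), tripleEquiv_apply]
  have hv : volume (planeEquiv '' K) = volume K := volume_image_equiv measurePreserving_planeEquiv K
  have hvr : volume.real (planeEquiv '' K) = (volume K).toReal := by rw [Measure.real, hv]
  rw [expVolSimplex, setAverage_eq]
  simp_rw [hvol]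
  rw [measureReal_def, volume_pi_pi, hpre,
    measurePreserving_tripleEquiv.setIntegral_preimage_emb tripleEquiv.measurableEmbedding
      (fun z => triArea z.1 z.2.1 z.2.2),
    integral_eq_lintegral_of_nonneg_ae (Filter.Eventually.of_forall fun z => triArea_nonneg _ _ _)
      (by fun_prop : Measurable fun z : (ℝ × ℝ) × (ℝ × ℝ) × (ℝ × ℝ) =>
        triArea z.1 z.2.1 z.2.2).aestronglyMeasurable, ← triInt_eq_prod, hvr,
    ENNReal.toReal_div, ENNReal.toReal_ofReal (by positivity)]
  simp [div_eq_inv_mul]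

lemma integral_abs_sub {a b : ℝ} (hab : a ≤ b) :
    ∫ z in Icc a b ×ˢ Icc a b, |z.1 - z.2| = (b - a) ^ 3 / 3 := by
  have hin : ∀ x ∈ uIcc a b, ∫ y in a..b, |x - y| = ((x - a) ^ 2 + (b - x) ^ 2) / 2 := by
    intro x hx
    rw [uIcc_of_le hab] at hx
    have hc : Continuous fun y => |x - y| := by fun_prop
    rw [← intervalIntegral.integral_add_adjacent_intervals (hc.intervalIntegrable a x)
      (hc.intervalIntegrable x b)]
    have e1 : ∫ y in a..x, |x - y| = ∫ y in a..x, (x - y) :=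
      intervalIntegral.integral_congr fun y hy => by
        rw [uIcc_of_le hx.1] at hy
        exact abs_of_nonneg (sub_nonneg.2 hy.2)
    have e2 : ∫ y in x..b, |x - y| = ∫ y in x..b, (y - x) :=
      intervalIntegral.integral_congr fun y hy => by
        rw [uIcc_of_le hx.2] at hy
        exact (abs_of_nonpos (sub_nonpos.2 hy.1)).trans (neg_sub _ _)
    rw [e1, e2, intervalIntegral.integral_comp_sub_left (fun t => t) x,
      intervalIntegral.integral_comp_sub_right (fun t => t) x, integral_id, integral_id]
    ring
  have hc : Continuous fun z : ℝ × ℝ => |z.1 - z.2| := by fun_prop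
  rw [Measure.volume_eq_prod, setIntegral_prod _
    (hc.continuousOn.integrableOn_compact (isCompact_Icc.prod isCompact_Icc))]
  simp_rw [integral_Icc_eq_integral_Ioc, ← intervalIntegral.integral_of_le hab]
  rw [intervalIntegral.integral_congr hin]
  have h1 : IntervalIntegrable (fun x => (x - a) ^ 2) volume a b :=
    Continuous.intervalIntegrable (by fun_prop) _ _
  have h2 : IntervalIntegrable (fun x => (b - x) ^ 2) volume a b :=
    Continuous.intervalIntegrable (by fun_prop) _ _
  rw [intervalIntegral.integral_div, intervalIntegral.integral_add h1 h2,
    intervalIntegral.integral_comp_sub_right (fun t => t ^ 2) a,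
    intervalIntegral.integral_comp_sub_left (fun t => t ^ 2) b, integral_pow, integral_pow]
  norm_num

lemma expVolSimplex_one {K : Set (EuclideanSpace ℝ (Fin 1))} (hK : IsCompact K)
    (hconv : Convex ℝ K) (hne : K.Nonempty) :
    expVolSimplex 1 K = (volume K).toReal / 3 := by
  have hcomp : IsCompact (lineEquiv '' K) := hK.image lineEquiv.continuous
  have hcon : IsConnected (lineEquiv '' K) :=
    ⟨hne.image _, (hconv.isPreconnected).image _ lineEquiv.continuous.continuousOn⟩
  have hI := eq_Icc_of_connected_compact hcon hcomp
  set a := sInf (lineEquiv '' K)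
  set b := sSup (lineEquiv '' K)
  have hab : a ≤ b := nonempty_Icc.1 (hI ▸ hcon.nonempty)
  have hpre : univ.pi (fun _ : Fin 2 => K) = pairEquiv ⁻¹' (Icc a b ×ˢ Icc a b) := by
    rw [← hI]
    ext X
    simp [pairEquiv_apply, Fin.forall_fin_succ]
  have hvol : ∀ X : Fin 2 → EuclideanSpace ℝ (Fin 1), (volume (convexHull ℝ (range X))).toReal =
      |(pairEquiv X).1 - (pairEquiv X).2| := fun X => by
    have hr : lineEquiv '' range X = {lineEquiv (X 0), lineEquiv (X 1)} := by
      rw [← range_comp]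
      ext p
      simp [Fin.exists_fin_succ, eq_comm]
    rw [volume_convexHull_equiv measurePreserving_lineEquiv, hr, convexHull_pair,
      segment_eq_uIcc, Real.volume_interval, ENNReal.toReal_ofReal (abs_nonneg _), abs_sub_comm,
      pairEquiv_apply]
  have hv : (volume K).toReal = b - a := by
    rw [← volume_image_equiv measurePreserving_lineEquiv K, hI, Real.volume_Icc,
      ENNReal.toReal_ofReal (sub_nonneg.2 hab)]
  rw [expVolSimplex, setAverage_eq]
  simp_rw [hvol]
  rw [measureReal_def, volume_pi_pi, hpre,
    measurePreserving_pairEquiv.setIntegral_preimage_emb pairEquiv.measurableEmbedding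
      (fun z => |z.1 - z.2|), integral_abs_sub hab]
  simp only [Finset.prod_const, Finset.card_univ, Fintype.card_fin, ENNReal.toReal_pow, hv,
    smul_eq_mul]
  rcases hab.eq_or_lt with h | h
  · simp [h]
  · have := sub_pos.2 h
    field_simp

end RandomTriangle

/-- In dimensions 1 and 2, the expected volume of a random simplex is monotone
under inclusion of convex bodies. -/
theorem expVolSimplex_monotone_low_dim
    (d : ℕ) (hd : d = 1 ∨ d = 2)
    (K L : Set (EuclideanSpace ℝ (Fin d)))
    (hK : IsConvexBody K) (hL : IsConvexBody L) (hKL : K ⊆ L) :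
    expVolSimplex d K ≤ expVolSimplex d L := by
  open RandomTriangle in
  obtain ⟨hKc, hKv, hKi⟩ := hK
  obtain ⟨hLc, hLv, hLi⟩ := hL
  have hL0 : volume L ≠ 0 := (Measure.measure_pos_of_nonempty_interior _ hLi).ne'
  rcases hd with rfl | rfl
  · rw [expVolSimplex_one hKc hKv (hKi.mono interior_subset),
      expVolSimplex_one hLc hLv (hLi.mono interior_subset)]
    have := ENNReal.toReal_mono hLc.measure_lt_top.ne (measure_mono (μ := volume) hKL)
    linarith
  · rw [expVolSimplex_two, expVolSimplex_two]
    have hcK : IsCompact (planeEquiv '' K) := hKc.image planeEquiv.continuous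
    have hcL : IsCompact (planeEquiv '' L) := hLc.image planeEquiv.continuous
    have hvK : Convex ℝ (planeEquiv '' K) := hKv.linear_image planeEquiv.toLinearMap
    have hvL : Convex ℝ (planeEquiv '' L) := hLv.linear_image planeEquiv.toLinearMap
    have hiK : (interior (planeEquiv '' K)).Nonempty := by
      have := planeEquiv.toHomeomorph.image_interior K
      rw [ContinuousLinearEquiv.coe_toHomeomorph] at this
      rw [← this]
      exact hKi.image _
    have hLpos : 0 < volume.real (planeEquiv '' L) := by
      rw [measureReal_def, volume_image_equiv measurePreserving_planeEquiv]
      exact ENNReal.toReal_pos hL0 hLc.measure_lt_top.ne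
    refine ENNReal.toReal_mono (ENNReal.div_ne_top ?_ ?_)
      (triInt_div_le hcK hvK hiK hcL hvL (Set.image_mono hKL))
    · exact ne_top_of_le_ne_top ENNReal.ofReal_ne_top (triInt_le hcL hvL)
    · exact (ENNReal.ofReal_pos.2 (by positivity)).ne'
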